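/- Assume h Var[A_R] ≤ 1 and sup_{t ∈ [0,T]} ‖P_T(t)‖ ≤ κ for some κ > 0. Then there exists a constant C_T > 0, depending only on A, B, Q, W, F, T, and κ, such that for all t ∈ [0,T], E[‖P_R(·,t) − P_T(t)‖] ≤ C_T e^{2μ_R T} √(h Var[A_R]), where P_T solves the Riccati differential equation −Ṗ_T(t) = AᵀP_T(t) + P_T(t)A − P_T(t)BW⁻¹BᵀP_T(t) + Q with P_T(T) = F, and for each ω, P_R(ω,·) solves the randomized Riccati differential equation −Ṗ_R(ω,t) = A_R(ω,t)ᵀP_R(ω,t) + P_R(ω,t)A_R(ω,t) − P_R(ω,t)BW⁻¹BᵀP_R(ω,t) + Q with P_R(ω,T) = F. -/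

import Mathlib

open MeasureTheory Matrix Set

attribute [local instance] Matrix.frobeniusNormedAddCommGroup Matrix.frobeniusNormedSpace

noncomputable section

/-- The Euclidean norm of a vector in `Fin n → ℝ`. -/
def eN {n : ℕ} (x : Fin n → ℝ) : ℝ := Real.sqrt (∑ i, x i ^ 2)

/-- The continuous linear map on Euclidean space induced by a matrix. -/
def clm {n r : ℕ} (A : Matrix (Fin n) (Fin r) ℝ) :
    EuclideanSpace ℝ (Fin r) →L[ℝ] EuclideanSpace ℝ (Fin n) :=
  LinearMap.toContinuousLinearMap (Matrix.toEuclideanLin A)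

/-- The operator norm of a matrix induced by the Euclidean norms. -/
def opN {n r : ℕ} (A : Matrix (Fin n) (Fin r) ℝ) : ℝ := ‖clm A‖

/-- The seminorm `|x|_M = √(xᵀ M x)` associated to a positive semidefinite matrix `M`. -/
def qN {n : ℕ} (M : Matrix (Fin n) (Fin n) ℝ) (x : Fin n → ℝ) : ℝ :=
  Real.sqrt (x ⬝ᵥ (M *ᵥ x))

/-- The `L²(a,b;ℝ^m)`-norm of a control. -/
def l2N {m : ℕ} (u : ℝ → Fin m → ℝ) (a b : ℝ) : ℝ :=
  Real.sqrt (∫ s in a..b, (eN (u s)) ^ 2)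

/-- The probability `π_m` that the index `m` is contained in the selected subset. -/
def piP {M : ℕ} (S : Fin (2 ^ M) → Finset (Fin M)) (p : Fin (2 ^ M) → ℝ) (m : Fin M) : ℝ :=
  ∑ ω ∈ Finset.univ.filter (fun ω => m ∈ S ω), p ω

/-- The random batch matrix `Σ_{m ∈ S_ω} A_m / π_m` associated to a subset index `ω`. -/
def batchM {n M : ℕ} (As : Fin M → Matrix (Fin n) (Fin n) ℝ)
    (S : Fin (2 ^ M) → Finset (Fin M)) (p : Fin (2 ^ M) → ℝ) (ω : Fin (2 ^ M)) :
    Matrix (Fin n) (Fin n) ℝ :=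
  ∑ m ∈ S ω, (piP S p m)⁻¹ • As m

/-- The piecewise constant randomized matrix `A_R(ω,t)`, equal to `Σ_{m ∈ S_{ω_k}} A_m/π_m`
for `t ∈ [(k-1)h, kh)`. -/
def AR {n M K : ℕ} (As : Fin M → Matrix (Fin n) (Fin n) ℝ)
    (S : Fin (2 ^ M) → Finset (Fin M)) (p : Fin (2 ^ M) → ℝ) (h : ℝ)
    (ω : Fin K → Fin (2 ^ M)) (t : ℝ) : Matrix (Fin n) (Fin n) ℝ :=
  if hK : 0 < K then
    batchM As S p (ω ⟨min ⌊t / h⌋₊ (K - 1),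
      Nat.lt_of_le_of_lt (min_le_right _ _) (Nat.sub_lt hK one_pos)⟩)
  else 0

/-- The variance `Var[A_R] = Σ_ω p_ω ‖A − Σ_{m ∈ S_ω} A_m/π_m‖²`. -/
def varAR {n M : ℕ} (A : Matrix (Fin n) (Fin n) ℝ) (As : Fin M → Matrix (Fin n) (Fin n) ℝ)
    (S : Fin (2 ^ M) → Finset (Fin M)) (p : Fin (2 ^ M) → ℝ) : ℝ :=
  ∑ ω : Fin (2 ^ M), p ω * (opN (A - batchM As S p ω)) ^ 2

/-- Expectation of a random variable depending on `ω = (ω_1,…,ω_K)`. -/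
def expec {M K : ℕ} (p : Fin (2 ^ M) → ℝ) (X : (Fin K → Fin (2 ^ M)) → ℝ) : ℝ :=
  ∑ ω : Fin K → Fin (2 ^ M), (∏ k, p (ω k)) * X ω

/-- Expectation of a random variable depending on a sequence `(ω_1, ω_2, …)` of batch draws
through its first `i` entries only. -/
def expecSeq {M K : ℕ} (p : Fin (2 ^ M) → ℝ) (i : ℕ)
    (X : (ℕ → Fin K → Fin (2 ^ M)) → ℝ) : ℝ :=
  ∑ Ω : Fin i → Fin K → Fin (2 ^ M), (∏ j, ∏ k, p (Ω j k)) *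
    X (fun j => if hj : j < i then Ω ⟨j, hj⟩ else fun _ => ⟨0, Nat.two_pow_pos M⟩)

end

section helpers

variable {n : ℕ}

/-- Frobenius inner product. -/
noncomputable def ip (X Y : Matrix (Fin n) (Fin n) ℝ) : ℝ := (Xᵀ * Y).trace

/-- The right-hand side of the Riccati equation. -/
noncomputable def Ric (A G Q P : Matrix (Fin n) (Fin n) ℝ) : Matrix (Fin n) (Fin n) ℝ :=
  Aᵀ * P + P * A - P * G * P + Q

/-- Solution on a closed interval. -/
def IntSol (A G Q : Matrix (Fin n) (Fin n) ℝ) (P : ℝ → Matrix (Fin n) (Fin n) ℝ) (a b : ℝ) :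
    Prop :=
  ∀ t ∈ Icc a b, HasDerivWithinAt P (-(Ric A G Q (P t))) (Icc a b) t

lemma ip_eq_sum (X Y : Matrix (Fin n) (Fin n) ℝ) : ip X Y = ∑ i, ∑ j, X i j * Y i j := by
  simp only [ip, Matrix.trace, Matrix.diag, Matrix.mul_apply, Matrix.transpose_apply]
  rw [Finset.sum_comm]

lemma ip_self (X : Matrix (Fin n) (Fin n) ℝ) : ip X X = ‖X‖ ^ 2 := by
  rw [ip_eq_sum, Matrix.frobenius_norm_def, ← Real.sqrt_eq_rpow, Real.sq_sqrt]
  · simp [pow_two]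
  · positivity

lemma ip_add_left (X Y Z : Matrix (Fin n) (Fin n) ℝ) : ip (X + Y) Z = ip X Z + ip Y Z := by
  simp [ip, Matrix.add_mul]

lemma ip_sub_left (X Y Z : Matrix (Fin n) (Fin n) ℝ) : ip (X - Y) Z = ip X Z - ip Y Z := by
  simp [ip, Matrix.sub_mul]

lemma ip_add_right (X Y Z : Matrix (Fin n) (Fin n) ℝ) : ip X (Y + Z) = ip X Y + ip X Z := by
  simp [ip, Matrix.mul_add]

lemma ip_sub_right (X Y Z : Matrix (Fin n) (Fin n) ℝ) : ip X (Y - Z) = ip X Y - ip X Z := by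
  simp [ip, Matrix.mul_sub]

lemma ip_neg_right (X Y : Matrix (Fin n) (Fin n) ℝ) : ip X (-Y) = - ip X Y := by
  simp [ip]

lemma ip_le (X Y : Matrix (Fin n) (Fin n) ℝ) : ip X Y ≤ ‖X‖ * ‖Y‖ := by
  have h : (ip X Y) ^ 2 ≤ (‖X‖ * ‖Y‖) ^ 2 := by
    rw [mul_pow, ← ip_self, ← ip_self, ip_eq_sum, ip_eq_sum, ip_eq_sum]
    simp only [← Finset.sum_product', Finset.univ_product_univ]
    have := Finset.sum_mul_sq_le_sq_mul_sq Finset.univ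
      (fun x : Fin n × Fin n => X x.1 x.2) (fun x => Y x.1 x.2)
    simpa [pow_two] using this
  exact (le_abs_self _).trans (abs_le_of_sq_le_sq h (by positivity))

open scoped MatrixOrder in
lemma trace_mul_nonneg_aux {X Y : Matrix (Fin n) (Fin n) ℝ} (hX : X.PosSemidef)
    (hY : Y.PosSemidef) : 0 ≤ (X * Y).trace := by
  obtain ⟨Z, rfl⟩ := (CStarAlgebra.nonneg_iff_eq_star_mul_self).mp hX.nonneg
  rw [Matrix.star_eq_conjTranspose, Matrix.mul_assoc, Matrix.trace_mul_comm]
  exact (hY.mul_mul_conjTranspose_same Z).trace_nonneg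

lemma continuous_Ric (A G Q : Matrix (Fin n) (Fin n) ℝ) : Continuous (Ric A G Q) := by
  unfold Ric
  fun_prop

lemma IntSol.continuousOn {A G Q : Matrix (Fin n) (Fin n) ℝ}
    {P : ℝ → Matrix (Fin n) (Fin n) ℝ} {a b : ℝ} (h : IntSol A G Q P a b) :
    ContinuousOn P (Icc a b) := fun t ht => (h t ht).continuousWithinAt

lemma hasDeriv_ip {X Y : ℝ → Matrix (Fin n) (Fin n) ℝ} {X' Y' : Matrix (Fin n) (Fin n) ℝ}
    {s : Set ℝ} {t : ℝ} (hX : HasDerivWithinAt X X' s t) (hY : HasDerivWithinAt Y Y' s t) :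
    HasDerivWithinAt (fun r => ip (X r) (Y r)) (ip X' (Y t) + ip (X t) Y') s t := by
  have entry : ∀ {Z : ℝ → Matrix (Fin n) (Fin n) ℝ} {Z' : Matrix (Fin n) (Fin n) ℝ},
      HasDerivWithinAt Z Z' s t → ∀ i j, HasDerivWithinAt (fun r => Z r i j) (Z' i j) s t := by
    intro Z Z' hZ i j
    exact ((Matrix.entryLinearMap ℝ ℝ i j :
      Matrix (Fin n) (Fin n) ℝ →ₗ[ℝ] ℝ).toContinuousLinearMap.hasFDerivAt).comp_hasDerivWithinAt
        t hZ
  simp only [ip_eq_sum]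
  rw [← Finset.sum_add_distrib]
  simp only [← Finset.sum_add_distrib]
  exact HasDerivWithinAt.fun_sum fun i _ => HasDerivWithinAt.fun_sum fun j _ =>
    (entry hX i j).mul (entry hY i j)

lemma continuous_ip : Continuous (fun x : Matrix (Fin n) (Fin n) ℝ × Matrix (Fin n) (Fin n) ℝ =>
    ip x.1 x.2) := by
  unfold ip
  fun_prop

lemma hasDeriv_transpose {X : ℝ → Matrix (Fin n) (Fin n) ℝ} {X' : Matrix (Fin n) (Fin n) ℝ}
    {s : Set ℝ} {t : ℝ} (hX : HasDerivWithinAt X X' s t) :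
    HasDerivWithinAt (fun r => (X r)ᵀ) X'ᵀ s t :=
  (((Matrix.transposeLinearEquiv (Fin n) (Fin n) ℝ ℝ).toLinearMap :
      Matrix (Fin n) (Fin n) ℝ →ₗ[ℝ] Matrix (Fin n) (Fin n) ℝ
      ).toContinuousLinearMap.hasFDerivAt).comp_hasDerivWithinAt t hX

lemma hasDeriv_of_integral {E : Type*} [NormedAddCommGroup E] [NormedSpace ℝ E] [CompleteSpace E]
    {f g₀ : ℝ → E} {a b : ℝ} (hab : a ≤ b) (hc : ContinuousOn g₀ (Icc a b))
    (hP : ∀ t ∈ Icc a b, f t = f b + ∫ s in t..b, g₀ s) :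
    ∀ t ∈ Icc a b, HasDerivWithinAt f (-(g₀ t)) (Icc a b) t := by
  intro t ht
  let g : ℝ → E := IccExtend hab ((Icc a b).domRestrict g₀)
  have hg : Continuous g :=
    (continuousOn_iff_continuous_domRestrict.mp hc).Icc_extend'
  have hgt : ∀ s ∈ Icc a b, g s = g₀ s := fun s hs => by
    simp only [g, IccExtend_of_mem hab _ hs]; rfl
  have key : ∀ s ∈ Icc a b, f s = f b + ∫ r in s..b, g r := by
    intro s hs
    rw [hP s hs]
    congr 1
    apply intervalIntegral.integral_congr
    intro r hr
    rw [uIcc_of_le hs.2] at hr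
    exact (hgt r ⟨hs.1.trans hr.1, hr.2⟩).symm
  have hd : HasDerivAt (fun s => f b + ∫ r in s..b, g r) (-(g t)) t :=
    (intervalIntegral.integral_hasDerivAt_left (hg.intervalIntegrable _ _)
      (hg.stronglyMeasurableAtFilter _ _) hg.continuousAt).const_add _
  rw [← hgt t ht]
  exact hd.hasDerivWithinAt.congr key (key t ht)

/-- From integral form to differential form. -/
lemma intSol_of_integral {A G Q : Matrix (Fin n) (Fin n) ℝ}
    {P : ℝ → Matrix (Fin n) (Fin n) ℝ} {a b : ℝ} (hab : a ≤ b) (hc : ContinuousOn P (Icc a b))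
    (hP : ∀ t ∈ Icc a b, P t = P b + ∫ s in t..b, Ric A G Q (P s)) : IntSol A G Q P a b :=
  hasDeriv_of_integral hab ((continuous_Ric A G Q).comp_continuousOn hc) hP

lemma IntSol.mono {A G Q : Matrix (Fin n) (Fin n) ℝ}
    {P : ℝ → Matrix (Fin n) (Fin n) ℝ} {a b c d : ℝ} (h : IntSol A G Q P a b) (hac : a ≤ c)
    (hdb : d ≤ b) : IntSol A G Q P c d := fun t ht =>
  (h t ⟨hac.trans ht.1, ht.2.trans hdb⟩).mono (Icc_subset_Icc hac hdb)

lemma Ric_sub (A G Q P R : Matrix (Fin n) (Fin n) ℝ) :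
    Ric A G Q P - Ric A G Q R =
      Aᵀ * (P - R) + (P - R) * A - ((P - R) * G * P + R * G * (P - R)) := by
  unfold Ric; noncomm_ring

lemma intSol_unique {A G Q : Matrix (Fin n) (Fin n) ℝ}
    {P R : ℝ → Matrix (Fin n) (Fin n) ℝ} {a b : ℝ} (hP : IntSol A G Q P a b)
    (hR : IntSol A G Q R a b) (hb : P b = R b) : EqOn P R (Icc a b) := by
  obtain ⟨c1, hc1⟩ := isCompact_Icc.exists_bound_of_continuousOn hP.continuousOn
  obtain ⟨c2, hc2⟩ := isCompact_Icc.exists_bound_of_continuousOn hR.continuousOn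
  let c := max 0 (max c1 c2)
  have hc0 : 0 ≤ c := le_max_left _ _
  have hder : ∀ {Z : ℝ → Matrix (Fin n) (Fin n) ℝ}, IntSol A G Q Z a b → ∀ t ∈ Ioc a b,
      HasDerivWithinAt Z (-(Ric A G Q (Z t))) (Iic t) t := by
    intro Z hZ t ht
    refine ((hZ t (Ioc_subset_Icc_self ht)).mono (Icc_subset_Icc_right ht.2)).mono_of_mem_nhdsWithin ?_
    exact Icc_mem_nhdsLE ht.1
  have hlip : LipschitzOnWith (Real.toNNReal (2 * ‖A‖ + 2 * ‖G‖ * c))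
      (fun X => -(Ric A G Q X)) (Metric.closedBall 0 c) := by
    apply LipschitzOnWith.of_dist_le_mul
    intro X hX Y hY
    rw [mem_closedBall_zero_iff] at hX hY
    rw [Real.coe_toNNReal _ (by positivity), dist_neg_neg, dist_eq_norm, dist_eq_norm, Ric_sub]
    have e1 : ‖Aᵀ * (X - Y)‖ ≤ ‖A‖ * ‖X - Y‖ := by
      simpa [Matrix.frobenius_norm_transpose] using Matrix.frobenius_norm_mul Aᵀ (X - Y)
    have e2 : ‖(X - Y) * A‖ ≤ ‖X - Y‖ * ‖A‖ := Matrix.frobenius_norm_mul _ _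
    have e3 : ‖(X - Y) * G * X‖ ≤ ‖X - Y‖ * ‖G‖ * c :=
      (Matrix.frobenius_norm_mul _ _).trans (mul_le_mul (Matrix.frobenius_norm_mul _ _) hX
        (norm_nonneg _) (by positivity))
    have e4 : ‖Y * G * (X - Y)‖ ≤ c * ‖G‖ * ‖X - Y‖ :=
      (Matrix.frobenius_norm_mul _ _).trans (mul_le_mul_of_nonneg_right
        ((Matrix.frobenius_norm_mul _ _).trans (by gcongr)) (norm_nonneg _))
    have := norm_sub_le (Aᵀ * (X - Y) + (X - Y) * A) ((X - Y) * G * X + Y * G * (X - Y))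
    have := norm_add_le (Aᵀ * (X - Y)) ((X - Y) * A)
    have := norm_add_le ((X - Y) * G * X) (Y * G * (X - Y))
    nlinarith
  refine ODE_solution_unique_of_mem_Icc_left (v := fun _ X => -(Ric A G Q X))
    (s := fun _ => Metric.closedBall 0 c) (fun _ _ => hlip) hP.continuousOn (hder hP) ?_
    hR.continuousOn (hder hR) ?_ hb
  · intro t ht
    rw [mem_closedBall_zero_iff]
    exact (hc1 t (Ioc_subset_Icc_self ht)).trans ((le_max_left _ _).trans (le_max_right _ _))
  · intro t ht
    rw [mem_closedBall_zero_iff]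
    exact (hc2 t (Ioc_subset_Icc_self ht)).trans ((le_max_right _ _).trans (le_max_right _ _))

lemma intSol_symm {A G Q : Matrix (Fin n) (Fin n) ℝ} (hG : Gᵀ = G) (hQ : Qᵀ = Q)
    {P : ℝ → Matrix (Fin n) (Fin n) ℝ} {a b : ℝ} (hP : IntSol A G Q P a b)
    (hb : (P b)ᵀ = P b) : ∀ t ∈ Icc a b, (P t)ᵀ = P t := by
  refine intSol_unique (P := fun t => (P t)ᵀ) (fun t ht => ?_) hP hb
  have := hasDeriv_transpose (hP t ht)
  convert this using 1
  simp only [Ric, Matrix.transpose_neg, Matrix.transpose_add, Matrix.transpose_sub,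
    Matrix.transpose_mul, hG, hQ, Matrix.transpose_transpose, Matrix.mul_assoc]
  rw [add_comm (Aᵀ * _)]

lemma ftc_bound {f f' g : ℝ → ℝ} {a b : ℝ} (hab : a ≤ b)
    (hf : ∀ t ∈ Icc a b, HasDerivWithinAt f (-(f' t)) (Icc a b) t)
    (hg : ContinuousOn g (Icc a b)) (h : ∀ t ∈ Icc a b, f' t ≤ g t) :
    f a ≤ f b + ∫ t in a..b, g t := by
  have h1 : ∀ t ∈ Icc a b, HasDerivWithinAt (fun t => ∫ s in t..b, g s) (-(g t)) (Icc a b) t :=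
    hasDeriv_of_integral hab hg (by intro t _; simp)
  have h2 : MonotoneOn (fun t => f t - ∫ s in t..b, g s) (Icc a b) := by
    apply monotoneOn_of_hasDerivWithinAt_nonneg (convex_Icc a b) (f' := fun t => -(f' t) - -(g t))
    · exact fun t ht => ((hf t ht).sub (h1 t ht)).continuousWithinAt
    · intro t ht
      have ht' := interior_subset ht
      exact ((hf t ht').sub (h1 t ht')).mono interior_subset
    · intro t ht
      have := h t (interior_subset ht)
      linarith
  have := h2 (left_mem_Icc.mpr hab) (right_mem_Icc.mpr hab) hab
  simp only [intervalIntegral.integral_same] at this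
  linarith

lemma ip_vec (v : Fin n → ℝ) (X : Matrix (Fin n) (Fin n) ℝ) :
    ip (Matrix.vecMulVec v v) X = v ⬝ᵥ (X *ᵥ v) := by
  rw [ip_eq_sum]
  simp only [Matrix.vecMulVec_apply, dotProduct, Matrix.mulVec, Finset.mul_sum]
  exact Finset.sum_congr rfl fun i _ => Finset.sum_congr rfl fun j _ => by ring

lemma norm_vecMulVec_self (v : Fin n → ℝ) : ‖Matrix.vecMulVec v v‖ = v ⬝ᵥ v := by
  have h0 : 0 ≤ v ⬝ᵥ v := by
    simp only [dotProduct]; exact Finset.sum_nonneg fun i _ => mul_self_nonneg _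
  have h : ‖Matrix.vecMulVec v v‖ ^ 2 = (v ⬝ᵥ v) ^ 2 := by
    rw [← ip_self, ip_vec, Matrix.vecMulVec_mulVec]
    simp [dotProduct_smul, pow_two]
  exact (sq_eq_sq₀ (norm_nonneg _) h0).mp h

lemma quad_le (v : Fin n → ℝ) (X : Matrix (Fin n) (Fin n) ℝ) :
    v ⬝ᵥ (X *ᵥ v) ≤ ‖X‖ * (v ⬝ᵥ v) := by
  rw [← ip_vec, ← norm_vecMulVec_self, mul_comm]
  exact ip_le _ _

lemma dot_self_pos {v : Fin n → ℝ} (hv : v ≠ 0) : 0 < v ⬝ᵥ v := by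
  have h0 : 0 ≤ v ⬝ᵥ v := by
    simp only [dotProduct]; exact Finset.sum_nonneg fun i _ => mul_self_nonneg _
  exact lt_of_le_of_ne h0 (fun h => hv (dotProduct_self_eq_zero.mp h.symm))

lemma intSol_barrier {A G Q : Matrix (Fin n) (Fin n) ℝ} (hQ : Q.PosSemidef)
    {P : ℝ → Matrix (Fin n) (Fin n) ℝ} {a b : ℝ} (hP : IntSol A G Q P a b)
    (hsymm : ∀ t ∈ Icc a b, (P t)ᵀ = P t)
    (hb : (P b).PosSemidef) (δ : ℝ) (hδ : 0 < δ) (hδ1 : δ ≤ 1) :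
    ∀ t ∈ Icc a b, ∀ v : Fin n → ℝ, v ≠ 0 →
      0 < v ⬝ᵥ (P t *ᵥ v) + δ * Real.exp ((2 * ‖A‖ + ‖G‖ + 1) * (a - t)) * (v ⬝ᵥ v) := by
  set c := 2 * ‖A‖ + ‖G‖ + 1 with hc
  have hc0 : 0 < c := by positivity
  let η : ℝ → ℝ := fun t => δ * Real.exp (c * (a - t))
  have hη0 : ∀ t, 0 < η t := fun t => by positivity
  have hη1 : ∀ t, a ≤ t → η t ≤ 1 := fun t ht => by
    have : Real.exp (c * (a - t)) ≤ 1 := Real.exp_le_one_iff.mpr (by nlinarith)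
    have := Real.exp_pos (c * (a - t))
    change δ * _ ≤ 1
    nlinarith
  have hηd : ∀ t, HasDerivAt η (-(c * η t)) t := fun t => by
    have h1 : HasDerivAt (fun t => c * (a - t)) (c * (-1)) t :=
      ((hasDerivAt_id t).const_sub a).const_mul c
    have := (h1.exp).const_mul δ
    refine this.congr_deriv ?_
    change _ = -(c * (δ * Real.exp (c * (a - t))))
    ring
  have hηc : Continuous η := by fun_prop
  let f : ℝ × (Fin n → ℝ) → ℝ := fun x => x.2 ⬝ᵥ (P x.1 *ᵥ x.2) + η x.1 * (x.2 ⬝ᵥ x.2)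
  have hscale : ∀ t (r : ℝ) v, f (t, r • v) = r ^ 2 * f (t, v) := by
    intro t r v
    simp only [f, Matrix.mulVec_smul, smul_dotProduct, dotProduct_smul, smul_eq_mul]; ring
  have hfc : ContinuousOn f (Icc a b ×ˢ Metric.sphere (0 : Fin n → ℝ) 1) := by
    have h1 : ContinuousOn (fun x : ℝ × (Fin n → ℝ) => P x.1)
        (Icc a b ×ˢ Metric.sphere (0 : Fin n → ℝ) 1) :=
      hP.continuousOn.comp continuousOn_fst (fun x hx => hx.1)
    have h2 : Continuous (fun y : Matrix (Fin n) (Fin n) ℝ × (Fin n → ℝ) =>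
      y.2 ⬝ᵥ (y.1 *ᵥ y.2)) := by fun_prop
    have h3 : Continuous (fun x : ℝ × (Fin n → ℝ) => η x.1 * (x.2 ⬝ᵥ x.2)) := by fun_prop
    exact (h2.comp_continuousOn (h1.prodMk continuousOn_snd)).add h3.continuousOn
  have hcomp : IsCompact (Icc a b ×ˢ Metric.sphere (0 : Fin n → ℝ) 1) :=
    isCompact_Icc.prod (isCompact_sphere _ _)
  have hS : IsCompact ((Icc a b ×ˢ Metric.sphere (0 : Fin n → ℝ) 1) ∩ f ⁻¹' (Iic 0)) :=
    hcomp.of_isClosed_subset (hfc.preimage_isClosed_of_isClosed hcomp.isClosed isClosed_Iic)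
      inter_subset_left
  intro t ht v hv
  by_contra hneg
  push Not at hneg
  have hne : ((Icc a b ×ˢ Metric.sphere (0 : Fin n → ℝ) 1) ∩ f ⁻¹' (Iic 0)).Nonempty := by
    refine ⟨(t, ‖v‖⁻¹ • v), ⟨ht, ?_⟩, ?_⟩
    · simp [norm_smul, norm_ne_zero_iff.mpr hv]
    · rw [mem_preimage, hscale]
      exact mul_nonpos_of_nonneg_of_nonpos (sq_nonneg _) hneg
  obtain ⟨⟨t0, v0⟩, ⟨⟨ht0, hv0⟩, hf0⟩, hmax⟩ := hS.exists_isMaxOn hne continuousOn_fst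
  simp only at ht0 hv0
  have hv0' : v0 ≠ 0 := by
    rintro rfl; simp at hv0
  have hvv := dot_self_pos hv0'
  have hf0' : f (t0, v0) ≤ 0 := hf0
  have ht0b : t0 < b := by
    rcases ht0.2.lt_or_eq with h | h
    · exact h
    · exfalso
      have := hb.dotProduct_mulVec_nonneg v0
      simp only [star_trivial] at this
      have h2 : 0 < η t0 * (v0 ⬝ᵥ v0) := mul_pos (hη0 _) hvv
      simp only [f, h] at hf0'
      rw [h] at h2
      linarith
  have hpos : ∀ r ∈ Ioc t0 b, ∀ w : Fin n → ℝ, w ≠ 0 → 0 < f (r, w) := by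
    intro r hr w hw
    by_contra hcon
    push Not at hcon
    have hmem : (r, ‖w‖⁻¹ • w) ∈ ((Icc a b ×ˢ Metric.sphere (0 : Fin n → ℝ) 1) ∩ f ⁻¹' (Iic 0)) := by
      refine ⟨⟨⟨ht0.1.trans hr.1.le, hr.2⟩, ?_⟩, ?_⟩
      · simp [norm_smul, norm_ne_zero_iff.mpr hw]
      · rw [mem_preimage, hscale]
        exact mul_nonpos_of_nonneg_of_nonpos (sq_nonneg _) hcon
    have := hmax hmem
    simp only [mem_ofPred_eq] at this
    exact absurd hr.1 (not_lt.mpr this)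
  have hfd : ∀ w : Fin n → ℝ, HasDerivWithinAt (fun r => f (r, w))
      (-(w ⬝ᵥ (Ric A G Q (P t0) *ᵥ w)) - c * η t0 * (w ⬝ᵥ w)) (Ioc t0 b) t0 := by
    intro w
    have h1 := hasDeriv_ip (hasDerivWithinAt_const t0 (Icc a b) (Matrix.vecMulVec w w)) (hP t0 ht0)
    have h2 := ((hηd t0).hasDerivWithinAt (s := Icc a b)).mul_const (w ⬝ᵥ w)
    have h3 := (h1.add h2).mono (s := Ioc t0 b)
      (fun r hr => ⟨ht0.1.trans hr.1.le, hr.2⟩)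
    have h4 : (fun r => f (r, w)) =
        (fun r => ip (Matrix.vecMulVec w w) (P r)) + fun y => η y * w ⬝ᵥ w := by
      funext r
      simp only [f, Pi.add_apply, ip_vec]
    rw [h4]
    refine h3.congr_deriv ?_
    have h5 : ip 0 (P t0) = 0 := by simp [ip]
    rw [h5, ip_vec, Matrix.neg_mulVec, dotProduct_neg]
    ring
  have hbot : (nhdsWithin t0 (Ioc t0 b)).NeBot := by
    rw [nhdsWithin_Ioc_eq_nhdsGT ht0b]; infer_instance
  have hge : ∀ w : Fin n → ℝ, 0 ≤ f (t0, w) := by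
    intro w
    by_cases hw : w = 0
    · subst hw; simp [f]
    · refine ge_of_tendsto (hfd w).continuousWithinAt ?_
      filter_upwards [self_mem_nhdsWithin] with r hr
      exact (hpos r hr w hw).le
  have hf00 : f (t0, v0) = 0 := le_antisymm hf0' (hge v0)
  have hM : (P t0 + η t0 • (1 : Matrix (Fin n) (Fin n) ℝ)).PosSemidef := by
    apply Matrix.PosSemidef.of_dotProduct_mulVec_nonneg
    · rw [Matrix.IsHermitian, Matrix.conjTranspose_eq_transpose_of_trivial]
      simp [hsymm t0 ht0]
    · intro w
      have := hge w
      simpa [f, Matrix.add_mulVec, Matrix.smul_mulVec, dotProduct_add, dotProduct_smul] using this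
  have hker : P t0 *ᵥ v0 = -(η t0 • v0) := by
    have := (hM.dotProduct_mulVec_zero_iff v0).mp (by
      simpa [f, Matrix.add_mulVec, Matrix.smul_mulVec, dotProduct_add, dotProduct_smul] using hf00)
    rw [Matrix.add_mulVec, Matrix.smul_mulVec, Matrix.one_mulVec] at this
    exact eq_neg_of_add_eq_zero_left this
  have hker' : v0 ᵥ* P t0 = -(η t0 • v0) := by
    rw [← Matrix.mulVec_transpose, hsymm t0 ht0, hker]
  have hslope : 0 ≤ -(v0 ⬝ᵥ (Ric A G Q (P t0) *ᵥ v0)) - c * η t0 * (v0 ⬝ᵥ v0) := by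
    have := (hasDerivWithinAt_iff_tendsto_slope' (by simp)).mp (hfd v0)
    refine ge_of_tendsto this ?_
    filter_upwards [self_mem_nhdsWithin] with r hr
    rw [slope_def_field, hf00, sub_zero]
    exact div_nonneg (hpos r hr v0 hv0').le (sub_nonneg.mpr hr.1.le)
  have hcomp1 : v0 ⬝ᵥ (Ric A G Q (P t0) *ᵥ v0) =
      - 2 * η t0 * (v0 ⬝ᵥ (A *ᵥ v0)) - (η t0) ^ 2 * (v0 ⬝ᵥ (G *ᵥ v0)) + v0 ⬝ᵥ (Q *ᵥ v0) := by
    unfold Ric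
    rw [Matrix.add_mulVec, Matrix.sub_mulVec, Matrix.add_mulVec, dotProduct_add, dotProduct_sub,
      dotProduct_add, ← Matrix.mulVec_mulVec, ← Matrix.mulVec_mulVec, ← Matrix.mulVec_mulVec,
      ← Matrix.mulVec_mulVec, hker, dotProduct_mulVec v0 (P t0), dotProduct_mulVec v0 (P t0), hker',
      Matrix.mulVec_neg, Matrix.mulVec_neg, Matrix.mulVec_smul, Matrix.mulVec_smul,
      dotProduct_mulVec v0 Q]
    have : v0 ⬝ᵥ (Aᵀ *ᵥ v0) = v0 ⬝ᵥ (A *ᵥ v0) := by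
      rw [Matrix.mulVec_transpose, dotProduct_comm, dotProduct_mulVec]
    simp only [dotProduct_neg, neg_dotProduct, dotProduct_smul, smul_dotProduct, smul_eq_mul, this]
    ring
  have hq := hQ.dotProduct_mulVec_nonneg v0
  simp only [star_trivial] at hq
  have hA := quad_le v0 A
  have hG := quad_le v0 G
  rw [hcomp1] at hslope
  have h0 := hη0 t0
  have h1 := hη1 t0 ht0.1
  have e1 : 2 * η t0 * (v0 ⬝ᵥ (A *ᵥ v0)) ≤ 2 * η t0 * (‖A‖ * (v0 ⬝ᵥ v0)) := by gcongr
  have e2 : η t0 ^ 2 * (v0 ⬝ᵥ (G *ᵥ v0)) ≤ η t0 * (‖G‖ * (v0 ⬝ᵥ v0)) := by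
    have : η t0 ^ 2 * (v0 ⬝ᵥ (G *ᵥ v0)) ≤ η t0 ^ 2 * (‖G‖ * (v0 ⬝ᵥ v0)) := by gcongr
    refine this.trans (mul_le_mul_of_nonneg_right (by nlinarith) (by positivity))
  have e3 : 0 < η t0 * (v0 ⬝ᵥ v0) := mul_pos h0 hvv
  rw [hc] at hslope
  nlinarith

lemma intSol_psd {A G Q : Matrix (Fin n) (Fin n) ℝ} (hG : Gᵀ = G) (hQ : Q.PosSemidef)
    {P : ℝ → Matrix (Fin n) (Fin n) ℝ} {a b : ℝ} (hP : IntSol A G Q P a b)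
    (hb : (P b).PosSemidef) : ∀ t ∈ Icc a b, (P t).PosSemidef := by
  have htr : ∀ {X : Matrix (Fin n) (Fin n) ℝ}, X.PosSemidef → Xᵀ = X := fun {X} h => by
    have := h.isHermitian
    rwa [Matrix.IsHermitian, Matrix.conjTranspose_eq_transpose_of_trivial] at this
  have hs := intSol_symm hG (htr hQ) hP (htr hb)
  intro t ht
  apply Matrix.PosSemidef.of_dotProduct_mulVec_nonneg
  · rw [Matrix.IsHermitian, Matrix.conjTranspose_eq_transpose_of_trivial]
    exact hs t ht
  · intro v
    rw [star_trivial]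
    by_cases hv : v = 0
    · subst hv; simp
    have hvv := dot_self_pos hv
    by_contra hneg
    push Not at hneg
    have hb' := intSol_barrier hQ hP hs hb
    set X := v ⬝ᵥ (P t *ᵥ v)
    set Y := v ⬝ᵥ v
    have h1 := hb' (min 1 (-X / Y)) (lt_min one_pos (div_pos (by linarith) hvv)) (min_le_left _ _) t ht v hv
    have h2 : Real.exp ((2 * ‖A‖ + ‖G‖ + 1) * (a - t)) ≤ 1 := Real.exp_le_one_iff.mpr (by
      have : 0 ≤ 2 * ‖A‖ + ‖G‖ + 1 := by positivity
      nlinarith [ht.1])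
    have h3 : min 1 (-X / Y) * Real.exp ((2 * ‖A‖ + ‖G‖ + 1) * (a - t)) * Y ≤ (-X / Y) * 1 * Y := by
      have h4 : 0 ≤ -X / Y := (div_pos (by linarith) hvv).le
      gcongr
      exact min_le_right _ _
    have h5 : (-X / Y) * 1 * Y = -X := by field_simp
    linarith

lemma ip_comm' (X Y : Matrix (Fin n) (Fin n) ℝ) : ip X Y = ip Y X := by
  simp only [ip_eq_sum, mul_comm]

lemma ip_A_le {A X : Matrix (Fin n) (Fin n) ℝ} {μ : ℝ}
    (hA : ∀ x : Fin n → ℝ, x ⬝ᵥ (A *ᵥ x) ≤ μ * (eN x) ^ 2) (hX : Xᵀ = X) :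
    ip X (Aᵀ * X + X * A) ≤ 2 * μ * ‖X‖ ^ 2 := by
  have h1 : ip X (Aᵀ * X) = ip X (A * X) := by
    unfold ip
    rw [← Matrix.trace_transpose]
    simp only [Matrix.transpose_mul, Matrix.transpose_transpose, Matrix.mul_assoc, hX]
  have h2 : ip X (X * A) = ip X (A * X) := by
    unfold ip
    rw [hX, Matrix.trace_mul_comm, Matrix.mul_assoc, Matrix.trace_mul_comm, Matrix.mul_assoc,
      Matrix.trace_mul_comm, Matrix.mul_assoc, Matrix.trace_mul_comm, Matrix.mul_assoc]
  have h3 : ip X (A * X) = ∑ j, (fun i => X i j) ⬝ᵥ (A *ᵥ (fun i => X i j)) := by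
    rw [ip_eq_sum, Finset.sum_comm]
    rfl
  have h4 : ∑ j, (fun i => X i j) ⬝ᵥ (A *ᵥ (fun i => X i j)) ≤ μ * ‖X‖ ^ 2 := by
    rw [← ip_self, ip_eq_sum, Finset.sum_comm, Finset.mul_sum]
    refine Finset.sum_le_sum fun j _ => (hA _).trans (le_of_eq ?_)
    rw [eN, Real.sq_sqrt (Finset.sum_nonneg fun i _ => sq_nonneg _)]
    simp only [pow_two]
  rw [ip_add_right, h1, h2, h3]
  linarith

lemma hasDeriv_weighted {X : ℝ → Matrix (Fin n) (Fin n) ℝ} {X' : Matrix (Fin n) (Fin n) ℝ}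
    {s : Set ℝ} {t : ℝ} (l T : ℝ) (hX : HasDerivWithinAt X (-X') s t) :
    HasDerivWithinAt (fun r => Real.exp (-(l * (T - r))) * ‖X r‖ ^ 2)
      (-(Real.exp (-(l * (T - t))) * (2 * ip (X t) X' - l * ‖X t‖ ^ 2))) s t := by
  have h1 : HasDerivAt (fun r => -(l * (T - r))) (-(l * (-1))) t :=
    (((hasDerivAt_id t).const_sub T).const_mul l).neg
  have h2 := (h1.exp.hasDerivWithinAt (s := s)).mul (hasDeriv_ip hX hX)
  simp only [← ip_self]
  refine h2.congr_deriv ?_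
  rw [ip_comm' (-X'), ip_neg_right]
  ring

lemma ip_cubic_nonneg {G X P : Matrix (Fin n) (Fin n) ℝ} (hG : G.PosSemidef)
    (hX : Xᵀ = X) (hP : P.PosSemidef) : 0 ≤ (G * (X * P * X)).trace := by
  refine trace_mul_nonneg_aux hG ?_
  have := hP.mul_mul_conjTranspose_same X
  rwa [Matrix.conjTranspose_eq_transpose_of_trivial, hX] at this

lemma psd_symm {X : Matrix (Fin n) (Fin n) ℝ} (h : X.PosSemidef) : Xᵀ = X := by
  have := h.isHermitian
  rwa [Matrix.IsHermitian, Matrix.conjTranspose_eq_transpose_of_trivial] at this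

lemma norm_bound {A G Q : Matrix (Fin n) (Fin n) ℝ} (hG : G.PosSemidef)
    {P : ℝ → Matrix (Fin n) (Fin n) ℝ} {a b T μ : ℝ} (hP : IntSol A G Q P a b)
    (hpsd : ∀ t ∈ Icc a b, (P t).PosSemidef) (hμ : 0 ≤ μ) (hbT : b ≤ T)
    (hA : ∀ x : Fin n → ℝ, x ⬝ᵥ (A *ᵥ x) ≤ μ * (eN x) ^ 2) :
    ∀ t ∈ Icc a b, Real.exp (-((4 * μ + 1) * (T - t))) * ‖P t‖ ^ 2 ≤
      Real.exp (-((4 * μ + 1) * (T - b))) * ‖P b‖ ^ 2 + ‖Q‖ ^ 2 * (b - t) := by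
  intro t ht
  have key := ftc_bound (f := fun r => Real.exp (-((4 * μ + 1) * (T - r))) * ‖P r‖ ^ 2)
    (f' := fun r => Real.exp (-((4 * μ + 1) * (T - r))) *
      (2 * ip (P r) (Ric A G Q (P r)) - (4 * μ + 1) * ‖P r‖ ^ 2))
    (g := fun _ => ‖Q‖ ^ 2) ht.2
    (fun r hr => hasDeriv_weighted _ _ ((hP.mono ht.1 le_rfl) r hr)) continuousOn_const ?_
  · simpa [mul_comm] using key
  · intro r hr
    have hr' : r ∈ Icc a b := ⟨ht.1.trans hr.1, hr.2⟩
    have hs := psd_symm (hpsd r hr')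
    have e1 : Real.exp (-((4 * μ + 1) * (T - r))) ≤ 1 := Real.exp_le_one_iff.mpr (by
      have : 0 ≤ T - r := by linarith [hr.2]
      have := mul_nonneg (by linarith : 0 ≤ 4 * μ + 1) this
      linarith)
    have e0 := Real.exp_pos (-((4 * μ + 1) * (T - r)))
    have h1 := ip_A_le hA hs
    have h2 : ip (P r) (P r * G * P r) = (G * (P r * P r * P r)).trace := by
      unfold ip
      rw [hs, Matrix.mul_assoc (P r) G, ← Matrix.mul_assoc (P r) (P r), Matrix.trace_mul_comm]
      simp only [Matrix.mul_assoc]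
    have h3 := ip_cubic_nonneg hG hs (hpsd r hr')
    have h4 := ip_le (P r) Q
    have h5 : 2 * ip (P r) (Ric A G Q (P r)) - (4 * μ + 1) * ‖P r‖ ^ 2 ≤ ‖Q‖ ^ 2 := by
      unfold Ric
      rw [ip_add_right, ip_sub_right, h2]
      nlinarith [sq_nonneg (‖P r‖ - ‖Q‖)]
    calc _ ≤ Real.exp (-((4 * μ + 1) * (T - r))) * ‖Q‖ ^ 2 := by gcongr
      _ ≤ 1 * ‖Q‖ ^ 2 := by gcongr
      _ = _ := one_mul _

lemma norm_mul3 (X Y Z : Matrix (Fin n) (Fin n) ℝ) : ‖X * Y * Z‖ ≤ ‖X‖ * ‖Y‖ * ‖Z‖ :=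
  (Matrix.frobenius_norm_mul _ _).trans
    (mul_le_mul_of_nonneg_right (Matrix.frobenius_norm_mul _ _) (norm_nonneg _))

lemma energy_bound {A Ak G Q P R : Matrix (Fin n) (Fin n) ℝ} {μ k : ℝ} (hG : G.PosSemidef)
    (hP : P.PosSemidef) (hR : Rᵀ = R) (hk : ‖R‖ ≤ k)
    (hA : ∀ x : Fin n → ℝ, x ⬝ᵥ (Ak *ᵥ x) ≤ μ * (eN x) ^ 2) :
    2 * ip (P - R) (Ric Ak G Q P - Ric A G Q R) - (4 * μ + 6 * ‖G‖ * k) * ‖P - R‖ ^ 2 ≤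
      2 * ip (P - R) ((Ak - A)ᵀ * R + R * (Ak - A)) := by
  set E := P - R with hE
  have hs : Eᵀ = E := by rw [hE, Matrix.transpose_sub, psd_symm hP, hR]
  have hid : Ric Ak G Q P - Ric A G Q R = (Akᵀ * E + E * Ak) +
      ((Ak - A)ᵀ * R + R * (Ak - A)) - (E * G * E + E * G * R + R * G * E) := by
    rw [hE, Matrix.transpose_sub]; unfold Ric; noncomm_ring
  have h1 := ip_A_le hA hs
  have h2 : ip E (E * G * E) = (G * (E * P * E)).trace - (G * (E * R * E)).trace := by
    unfold ip
    rw [hs, Matrix.mul_assoc E G, ← Matrix.mul_assoc E E, Matrix.trace_mul_comm,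
      ← Matrix.trace_sub, ← Matrix.mul_sub, ← Matrix.sub_mul, ← Matrix.mul_sub, ← hE]
    simp only [Matrix.mul_assoc]
  have h3 := ip_cubic_nonneg hG hs hP
  have h4 : (G * (E * R * E)).trace ≤ ‖G‖ * k * ‖E‖ ^ 2 := by
    have : (G * (E * R * E)).trace = ip G (E * R * E) := by rw [ip, psd_symm hG]
    rw [this]
    refine (ip_le _ _).trans ((mul_le_mul_of_nonneg_left (norm_mul3 _ _ _) (norm_nonneg _)).trans ?_)
    have : ‖G‖ * (‖E‖ * ‖R‖ * ‖E‖) ≤ ‖G‖ * (‖E‖ * k * ‖E‖) := by gcongr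
    nlinarith
  have h5 : -ip E (E * G * R) ≤ ‖G‖ * k * ‖E‖ ^ 2 := by
    rw [← ip_neg_right]
    refine (ip_le _ _).trans ?_
    rw [norm_neg]
    refine (mul_le_mul_of_nonneg_left (norm_mul3 _ _ _) (norm_nonneg _)).trans ?_
    have : ‖E‖ * (‖E‖ * ‖G‖ * ‖R‖) ≤ ‖E‖ * (‖E‖ * ‖G‖ * k) := by gcongr
    nlinarith
  have h6 : -ip E (R * G * E) ≤ ‖G‖ * k * ‖E‖ ^ 2 := by
    rw [← ip_neg_right]
    refine (ip_le _ _).trans ?_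
    rw [norm_neg]
    refine (mul_le_mul_of_nonneg_left (norm_mul3 _ _ _) (norm_nonneg _)).trans ?_
    have : ‖E‖ * (‖R‖ * ‖G‖ * ‖E‖) ≤ ‖E‖ * (k * ‖G‖ * ‖E‖) := by gcongr
    nlinarith
  rw [hid, ip_sub_right, ip_add_right E (Akᵀ * E + E * Ak), ip_add_right E (E * G * E + E * G * R),
    ip_add_right E (E * G * E), h2]
  linarith

lemma drift_bound {A Ak G Q P R R₁ : Matrix (Fin n) (Fin n) ℝ} {k ρ h : ℝ} (hh : 0 < h)
    (hρ : 1 ≤ ρ) (hP : ‖P‖ ≤ ρ) (hk : ‖R‖ ≤ k) (hk1 : ‖R₁‖ ≤ k) :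
    ip (Ric Ak G Q P - Ric A G Q R) ((Ak - A)ᵀ * R₁ + R₁ * (Ak - A)) ≤
      h⁻¹ * ‖P - R‖ ^ 2 + ‖Ak - A‖ ^ 2 * ρ ^ 2 *
        (h * (k ^ 2 * (2 * ‖A‖ + k * ‖G‖ + ‖G‖) ^ 2) + 4 * k) := by
  set E := P - R with hE
  set D := Ak - A with hD
  have hk0 : 0 ≤ k := (norm_nonneg _).trans hk
  have hid : Ric Ak G Q P - Ric A G Q R = (Aᵀ * E + E * A) +
      (Dᵀ * P + P * D) - (E * G * P + R * G * E) := by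
    rw [hE, hD, Matrix.transpose_sub]; unfold Ric; noncomm_ring
  have hR1 : ‖Dᵀ * R₁ + R₁ * D‖ ≤ 2 * k * ‖D‖ := by
    have h1 := Matrix.frobenius_norm_mul Dᵀ R₁
    have h2 := Matrix.frobenius_norm_mul R₁ D
    rw [Matrix.frobenius_norm_transpose] at h1
    have := norm_add_le (Dᵀ * R₁) (R₁ * D)
    nlinarith [norm_nonneg D]
  have hN : ‖Ric Ak G Q P - Ric A G Q R‖ ≤
      ρ * ((2 * ‖A‖ + k * ‖G‖ + ‖G‖) * ‖E‖) + 2 * ‖D‖ * ρ := by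
    rw [hid]
    have h1 := Matrix.frobenius_norm_mul Aᵀ E
    have h2 := Matrix.frobenius_norm_mul E A
    have h3 := Matrix.frobenius_norm_mul Dᵀ P
    have h4 := Matrix.frobenius_norm_mul P D
    rw [Matrix.frobenius_norm_transpose] at h1 h3
    have h5 := norm_mul3 E G P
    have h6 := norm_mul3 R G E
    have h7 := norm_sub_le ((Aᵀ * E + E * A) + (Dᵀ * P + P * D)) (E * G * P + R * G * E)
    have h8 := norm_add_le (Aᵀ * E + E * A) (Dᵀ * P + P * D)
    have h9 := norm_add_le (Aᵀ * E) (E * A)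
    have h10 := norm_add_le (Dᵀ * P) (P * D)
    have h11 := norm_add_le (E * G * P) (R * G * E)
    have i1 : ‖A‖ * ‖E‖ ≤ ρ * (‖A‖ * ‖E‖) := le_mul_of_one_le_left (by positivity) hρ
    have i2 : ‖D‖ * ‖P‖ ≤ ‖D‖ * ρ := by gcongr
    have i3 : ‖E‖ * ‖G‖ * ‖P‖ ≤ ‖E‖ * ‖G‖ * ρ := by gcongr
    have i4 : ‖R‖ * ‖G‖ * ‖E‖ ≤ ρ * (k * ‖G‖ * ‖E‖) :=
      (by gcongr : ‖R‖ * ‖G‖ * ‖E‖ ≤ k * ‖G‖ * ‖E‖).trans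
        (le_mul_of_one_le_left (by positivity) hρ)
    linarith
  refine (ip_le _ _).trans ((mul_le_mul hN hR1 (norm_nonneg _) (by positivity)).trans ?_)
  set L := 2 * ‖A‖ + k * ‖G‖ + ‖G‖ with hL
  have hL0 : 0 ≤ L := by positivity
  -- Young inequality
  have hy : 2 * ‖E‖ * (ρ * L * k * ‖D‖) ≤ h⁻¹ * ‖E‖ ^ 2 + h * (ρ * L * k * ‖D‖) ^ 2 := by
    have := mul_nonneg (inv_nonneg.mpr hh.le) (sq_nonneg (‖E‖ - h * (ρ * L * k * ‖D‖)))
    have e : h⁻¹ * (‖E‖ - h * (ρ * L * k * ‖D‖)) ^ 2 = h⁻¹ * ‖E‖ ^ 2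
        - 2 * ‖E‖ * (ρ * L * k * ‖D‖) + h * (ρ * L * k * ‖D‖) ^ 2 := by
      field_simp
      ring
    linarith
  have hz : 4 * k * ‖D‖ ^ 2 * ρ ≤ 4 * k * ‖D‖ ^ 2 * ρ ^ 2 := by
    have : ρ ≤ ρ ^ 2 := by nlinarith
    gcongr
  nlinarith


set_option maxHeartbeats 2000000 in
lemma step_bound {A Ak G Q : Matrix (Fin n) (Fin n) ℝ} {P R : ℝ → Matrix (Fin n) (Fin n) ℝ}
    {μ k T Ck a b : ℝ} (hG : G.PosSemidef) (hμ : 0 ≤ μ) (hCk : 1 ≤ Ck) (hk0 : 0 ≤ k)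
    (hab : a < b) (hbT : b ≤ T) (hh : b - a ≤ T)
    (hP : IntSol Ak G Q P a b) (hR : IntSol A G Q R a b)
    (hPp : ∀ t ∈ Icc a b, (P t).PosSemidef) (hRs : ∀ t ∈ Icc a b, (R t)ᵀ = R t)
    (hRk : ∀ t ∈ Icc a b, ‖R t‖ ≤ k)
    (hPb : ∀ t ∈ Icc a b, ‖P t‖ ^ 2 ≤ Ck * Real.exp (4 * μ * (T - t)))
    (hA : ∀ x : Fin n → ℝ, x ⬝ᵥ (Ak *ᵥ x) ≤ μ * (eN x) ^ 2) :
    ∀ t ∈ Icc a b,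
      Real.exp (-((4 * μ + 6 * ‖G‖ * k) * (T - t))) * ‖P t - R t‖ ^ 2 ≤
      Real.exp (-((4 * μ + 6 * ‖G‖ * k) * (T - b))) * ‖P b - R b‖ ^ 2 +
      (∫ s in t..b, 2 * Real.exp (-((4 * μ + 6 * ‖G‖ * k) * (T - s))) *
        ip (P b - R b) ((Ak - A)ᵀ * R s + R s * (Ak - A))) +
      2 * (∫ s in t..b, Real.exp (-((4 * μ + 6 * ‖G‖ * k) * (T - s))) * ‖P s - R s‖ ^ 2) +
      (b - a) ^ 2 * (2 * Ck * (T * (k ^ 2 * (2 * ‖A‖ + k * ‖G‖ + ‖G‖) ^ 2) + 4 * k)) *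
        ‖Ak - A‖ ^ 2 := by
  intro t ht
  set l := 4 * μ + 6 * ‖G‖ * k with hl
  have hGk : 0 ≤ 6 * ‖G‖ * k := by positivity
  have hl0 : 0 ≤ l := by positivity
  set D := Ak - A with hD
  set h := b - a with hhdef
  have hh0 : 0 < h := by rw [hhdef]; linarith
  have htb : t ≤ b := ht.2
  have hsub : Icc t b ⊆ Icc a b := Icc_subset_Icc_left ht.1
  set w := k ^ 2 * (2 * ‖A‖ + k * ‖G‖ + ‖G‖) ^ 2 with hw
  have hw0 : 0 ≤ w := by positivity
  have hEc : ContinuousOn (fun s => P s - R s) (Icc a b) := hP.continuousOn.sub hR.continuousOn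
  have hthc : Continuous (fun s => Real.exp (-(l * (T - s)))) := by fun_prop
  have hφc : ContinuousOn (fun s => Real.exp (-(l * (T - s))) * ‖P s - R s‖ ^ 2) (Icc a b) :=
    hthc.continuousOn.mul (hEc.norm.pow 2)
  have hφ0 : ∀ s, 0 ≤ Real.exp (-(l * (T - s))) * ‖P s - R s‖ ^ 2 := fun s => by positivity
  have hRmc : ContinuousOn (fun s => Dᵀ * R s + R s * D) (Icc a b) :=
    (continuousOn_const.mul hR.continuousOn).add (hR.continuousOn.mul continuousOn_const)
  have hmid : ContinuousOn (fun s => 2 * Real.exp (-(l * (T - s))) *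
        ip (P b - R b) (Dᵀ * R s + R s * D)) (Icc a b) := by
    refine (continuousOn_const.mul hthc.continuousOn).mul ?_
    have hcc : Continuous (fun Y : Matrix (Fin n) (Fin n) ℝ => ip (P b - R b) Y) :=
      continuous_ip.comp (continuous_const.prodMk continuous_id)
    exact hcc.comp_continuousOn hRmc
  set Λ := ∫ s in t..b, Real.exp (-(l * (T - s))) * ‖P s - R s‖ ^ 2 with hΛ
  have hEd : ∀ q ∈ Icc a b, HasDerivWithinAt (fun s => P s - R s)
      (-(Ric Ak G Q (P q) - Ric A G Q (R q))) (Icc a b) q := fun q hq =>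
    ((hP q hq).sub (hR q hq)).congr_deriv (by abel)
  -- pointwise bound
  have hpt : ∀ s ∈ Icc t b, Real.exp (-(l * (T - s))) * (2 * ip (P s - R s)
      (Ric Ak G Q (P s) - Ric A G Q (R s)) - l * ‖P s - R s‖ ^ 2) ≤
      2 * Real.exp (-(l * (T - s))) * ip (P b - R b) (Dᵀ * R s + R s * D) +
        (2 * h⁻¹ * Λ + 2 * h * (Ck * (T * w + 4 * k)) * ‖D‖ ^ 2) := by
    intro s hs
    have hs' := hsub hs
    have hsb : s ≤ b := hs.2
    have hsubs : Icc s b ⊆ Icc a b := Icc_subset_Icc_left hs'.1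
    have he := energy_bound (Q := Q) hG (hPp s hs') (hRs s hs') (hRk s hs') hA (A := A)
    have hθ0 : 0 < Real.exp (-(l * (T - s))) := Real.exp_pos _
    set ρ := Real.sqrt (Ck * Real.exp (4 * μ * (T - s))) with hρ
    have hexp1 : 1 ≤ Real.exp (4 * μ * (T - s)) :=
      Real.one_le_exp (mul_nonneg (by positivity) (by linarith))
    have hρsq : ρ ^ 2 = Ck * Real.exp (4 * μ * (T - s)) := Real.sq_sqrt (by positivity)
    have hρ1 : 1 ≤ ρ := by
      rw [hρ]; apply Real.one_le_sqrt.mpr; nlinarith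
    have hPρ : ∀ q ∈ Icc s b, ‖P q‖ ≤ ρ := by
      intro q hq
      apply Real.le_sqrt_of_sq_le
      refine (hPb q (hsubs hq)).trans ?_
      have : Real.exp (4 * μ * (T - q)) ≤ Real.exp (4 * μ * (T - s)) :=
        Real.exp_le_exp.mpr (mul_le_mul_of_nonneg_left (by linarith [hq.1]) (by positivity))
      exact mul_le_mul_of_nonneg_left this (by linarith)
    have hf := ftc_bound (f := fun q => ip (P q - R q) (Dᵀ * R s + R s * D))
      (f' := fun q => ip (Ric Ak G Q (P q) - Ric A G Q (R q)) (Dᵀ * R s + R s * D))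
      (g := fun q => h⁻¹ * ‖P q - R q‖ ^ 2 + ‖D‖ ^ 2 * ρ ^ 2 * (h * w + 4 * k)) hsb
      (fun q hq => by
        have h1 := hasDeriv_ip ((hEd q (hsubs hq)).mono hsubs)
          (hasDerivWithinAt_const q (Icc s b) (Dᵀ * R s + R s * D))
        refine h1.congr_deriv ?_
        rw [ip_comm', ip_neg_right, ip_comm' _ (Ric Ak G Q (P q) - Ric A G Q (R q))]
        simp [ip])
      (((continuousOn_const.mul ((hEc.mono hsubs).norm.pow 2))).add continuousOn_const)
      (fun q hq => drift_bound hh0 hρ1 (hPρ q hq) (hRk q (hsubs hq)) (hRk s hs'))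
    have hIntg : IntervalIntegrable (fun q => h⁻¹ * ‖P q - R q‖ ^ 2) volume s b :=
      ContinuousOn.intervalIntegrable_of_Icc hsb
        (continuousOn_const.mul ((hEc.mono hsubs).norm.pow 2))
    rw [intervalIntegral.integral_add hIntg (by simp), intervalIntegral.integral_const,
      intervalIntegral.integral_const_mul, smul_eq_mul] at hf
    set J := ∫ q in s..b, ‖P q - R q‖ ^ 2 with hJ
    have hJΛ : Real.exp (-(l * (T - s))) * J ≤ Λ := by
      rw [hJ, ← intervalIntegral.integral_const_mul]
      calc _ ≤ ∫ q in s..b, Real.exp (-(l * (T - q))) * ‖P q - R q‖ ^ 2 := by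
            apply intervalIntegral.integral_mono_on hsb
            · exact ContinuousOn.intervalIntegrable_of_Icc hsb
                (continuousOn_const.mul ((hEc.mono hsubs).norm.pow 2))
            · exact ContinuousOn.intervalIntegrable_of_Icc hsb (hφc.mono hsubs)
            · intro q hq
              apply mul_le_mul_of_nonneg_right _ (by positivity)
              apply Real.exp_le_exp.mpr
              nlinarith [hq.1]
        _ ≤ Λ := by
            rw [hΛ, ← intervalIntegral.integral_add_adjacent_intervals (b := s)
              (ContinuousOn.intervalIntegrable_of_Icc hs.1 (hφc.mono
                (Icc_subset_Icc ht.1 hsb)))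
              (ContinuousOn.intervalIntegrable_of_Icc hsb (hφc.mono hsubs))]
            have : 0 ≤ ∫ q in t..s, Real.exp (-(l * (T - q))) * ‖P q - R q‖ ^ 2 :=
              intervalIntegral.integral_nonneg hs.1 (fun q _ => hφ0 q)
            linarith
    have hθρ : Real.exp (-(l * (T - s))) * ρ ^ 2 ≤ Ck := by
      rw [hρsq, mul_left_comm, ← Real.exp_add]
      have : Real.exp (-(l * (T - s)) + 4 * μ * (T - s)) ≤ 1 := by
        apply Real.exp_le_one_iff.mpr
        rw [hl]
        have : 0 ≤ 6 * ‖G‖ * k * (T - s) := mul_nonneg hGk (by linarith)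
        nlinarith
      nlinarith
    have hlast : Real.exp (-(l * (T - s))) * ((b - s) * (‖D‖ ^ 2 * ρ ^ 2 * (h * w + 4 * k))) ≤
        h * (Ck * (T * w + 4 * k)) * ‖D‖ ^ 2 := by
      have hb1 : b - s ≤ h := by rw [hhdef]; linarith [hs'.1]
      have hc1 : h * w + 4 * k ≤ T * w + 4 * k := by nlinarith
      calc _ = (b - s) * ((Real.exp (-(l * (T - s))) * ρ ^ 2) * (h * w + 4 * k)) * ‖D‖ ^ 2 := by
            ring
        _ ≤ _ := by
            have : 0 ≤ b - s := by linarith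
            have : 0 ≤ h * w + 4 * k := by positivity
            gcongr
    calc _ ≤ Real.exp (-(l * (T - s))) * (2 * ip (P s - R s) (Dᵀ * R s + R s * D)) :=
          mul_le_mul_of_nonneg_left he hθ0.le
      _ ≤ Real.exp (-(l * (T - s))) * (2 * (ip (P b - R b) (Dᵀ * R s + R s * D) +
            (h⁻¹ * J + (b - s) * (‖D‖ ^ 2 * ρ ^ 2 * (h * w + 4 * k))))) := by
          apply mul_le_mul_of_nonneg_left _ hθ0.le
          linarith
      _ = 2 * Real.exp (-(l * (T - s))) * ip (P b - R b) (Dᵀ * R s + R s * D) +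
            (2 * h⁻¹ * (Real.exp (-(l * (T - s))) * J) + 2 * (Real.exp (-(l * (T - s))) *
            ((b - s) * (‖D‖ ^ 2 * ρ ^ 2 * (h * w + 4 * k))))) := by ring
      _ ≤ _ := by
          have h3 : 2 * h⁻¹ * (Real.exp (-(l * (T - s))) * J) ≤ 2 * h⁻¹ * Λ :=
            mul_le_mul_of_nonneg_left hJΛ (by positivity)
          linarith
  have key := ftc_bound (f := fun r => Real.exp (-(l * (T - r))) * ‖P r - R r‖ ^ 2)
    (f' := fun s => Real.exp (-(l * (T - s))) * (2 * ip (P s - R s)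
      (Ric Ak G Q (P s) - Ric A G Q (R s)) - l * ‖P s - R s‖ ^ 2))
    (g := fun s => 2 * Real.exp (-(l * (T - s))) * ip (P b - R b) (Dᵀ * R s + R s * D) +
        (2 * h⁻¹ * Λ + 2 * h * (Ck * (T * w + 4 * k)) * ‖D‖ ^ 2)) htb
    (fun s hs => hasDeriv_weighted l T ((hEd s (hsub hs)).mono hsub))
    ((hmid.mono hsub).add continuousOn_const) hpt
  rw [intervalIntegral.integral_add
    (ContinuousOn.intervalIntegrable_of_Icc htb (hmid.mono hsub)) (by simp),
    intervalIntegral.integral_const, smul_eq_mul] at key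
  have hΛ0 : 0 ≤ Λ := intervalIntegral.integral_nonneg htb (fun q _ => hφ0 q)
  have hbt : b - t ≤ h := by rw [hhdef]; linarith [ht.1]
  have hT0 : 0 ≤ T := hh0.le.trans hh
  have hfin : (b - t) * (2 * h⁻¹ * Λ + 2 * h * (Ck * (T * w + 4 * k)) * ‖D‖ ^ 2) ≤
      2 * Λ + h ^ 2 * (2 * Ck * (T * w + 4 * k)) * ‖D‖ ^ 2 := by
    have h0 : 0 ≤ 2 * h⁻¹ * Λ + 2 * h * (Ck * (T * w + 4 * k)) * ‖D‖ ^ 2 := by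
      positivity
    calc _ ≤ h * (2 * h⁻¹ * Λ + 2 * h * (Ck * (T * w + 4 * k)) * ‖D‖ ^ 2) :=
          mul_le_mul_of_nonneg_right hbt h0
      _ = _ := by field_simp
  linarith

lemma gronwall_int {y : ℝ → ℝ} {a b α : ℝ} (hc : ContinuousOn y (Icc a b)) (hab : a ≤ b)
    (h : ∀ t ∈ Icc a b, y t ≤ α + 2 * ∫ s in t..b, y s) :
    ∀ t ∈ Icc a b, y t ≤ Real.exp (2 * (b - t)) * α := by
  have hd := hasDeriv_of_integral (f := fun t => ∫ s in t..b, y s) hab hc (by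
    intro t _; simp)
  intro t ht
  have hsub : Icc t b ⊆ Icc a b := Icc_subset_Icc_left ht.1
  have key := ftc_bound (f := fun r => Real.exp (-(2 * (b - r))) * (α + 2 * ∫ s in r..b, y s))
    (f' := fun r => Real.exp (-(2 * (b - r))) * (2 * y r - 2 * (α + 2 * ∫ s in r..b, y s)))
    (g := fun _ => 0) ht.2 (fun r hr => by
      have h1 : HasDerivAt (fun r : ℝ => -(2 * (b - r))) (-(2 * (-1))) r :=
        (((hasDerivAt_id r).const_sub b).const_mul 2).neg
      have h2 := (h1.exp.hasDerivWithinAt (s := Icc t b)).mul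
        ((((hd r (hsub hr)).mono hsub).const_mul 2).const_add α)
      exact h2.congr_deriv (by ring))
    continuousOn_const (fun r hr => by
      have := h r (hsub hr)
      have h0 := Real.exp_pos (-(2 * (b - r)))
      nlinarith)
  simp only [intervalIntegral.integral_same, intervalIntegral.integral_zero, sub_self, mul_zero,
    neg_zero, Real.exp_zero, one_mul, add_zero] at key
  have := h t ht
  rw [Real.exp_neg] at key
  have h0 := Real.exp_pos (2 * (b - t))
  have h2 : α + 2 * ∫ s in t..b, y s ≤ Real.exp (2 * (b - t)) * α := by
    rwa [inv_mul_le_iff₀ h0] at key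
  linarith

section expectation

variable {M K : ℕ} {p : Fin (2 ^ M) → ℝ}

lemma expec_mono (hp : ∀ a, 0 ≤ p a) {X Y : (Fin K → Fin (2 ^ M)) → ℝ} (h : ∀ ω, X ω ≤ Y ω) :
    expec p X ≤ expec p Y :=
  Finset.sum_le_sum fun ω _ => mul_le_mul_of_nonneg_left (h ω) (Finset.prod_nonneg fun _ _ => hp _)

lemma expec_nonneg (hp : ∀ a, 0 ≤ p a) {X : (Fin K → Fin (2 ^ M)) → ℝ} (h : ∀ ω, 0 ≤ X ω) :
    0 ≤ expec p X :=
  Finset.sum_nonneg fun ω _ => mul_nonneg (Finset.prod_nonneg fun _ _ => hp _) (h ω)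

lemma expec_add (X Y : (Fin K → Fin (2 ^ M)) → ℝ) :
    expec p (fun ω => X ω + Y ω) = expec p X + expec p Y := by
  simp [expec, mul_add, Finset.sum_add_distrib]

lemma expec_const_mul (c : ℝ) (X : (Fin K → Fin (2 ^ M)) → ℝ) :
    expec p (fun ω => c * X ω) = c * expec p X := by
  simp only [expec, Finset.mul_sum]
  exact Finset.sum_congr rfl fun _ _ => by ring

lemma expec_const (hs : ∑ a, p a = 1) (c : ℝ) :
    expec p (fun _ : Fin K → Fin (2 ^ M) => c) = c := by
  have h := Finset.prod_univ_sum (fun _ : Fin K => (Finset.univ : Finset (Fin (2 ^ M))))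
    (fun _ a => p a)
  simp only [hs, Finset.prod_const_one, Fintype.piFinset_univ] at h
  simp only [expec, ← Finset.sum_mul, ← h, one_mul]

lemma expec_resample (hs : ∑ a, p a = 1) (k : Fin K) (X : (Fin K → Fin (2 ^ M)) → ℝ) :
    expec p X = expec p (fun ω => ∑ a, p a * X (Function.update ω k a)) := by
  have h1 : expec p X = ∑ x : (Fin K → Fin (2 ^ M)) × Fin (2 ^ M),
      (∏ j, p (x.1 j)) * p x.2 * X x.1 := by
    rw [Fintype.sum_prod_type]
    refine Finset.sum_congr rfl fun ω _ => ?_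
    simp only
    rw [← Finset.sum_mul, ← Finset.mul_sum, hs, mul_one]
  have h2 : expec p (fun ω => ∑ a, p a * X (Function.update ω k a)) =
      ∑ x : (Fin K → Fin (2 ^ M)) × Fin (2 ^ M),
      (∏ j, p (x.1 j)) * p x.2 * X (Function.update x.1 k x.2) := by
    rw [Fintype.sum_prod_type]
    refine Finset.sum_congr rfl fun ω _ => ?_
    simp only [Finset.mul_sum, mul_assoc]
  rw [h1, h2]
  let f : (Fin K → Fin (2 ^ M)) × Fin (2 ^ M) → (Fin K → Fin (2 ^ M)) × Fin (2 ^ M) :=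
    fun x => (Function.update x.1 k x.2, x.1 k)
  have hf : Function.Involutive f := by
    rintro ⟨ω, a⟩
    simp [f]
  refine Fintype.sum_equiv hf.toPerm _ _ fun x => ?_
  obtain ⟨ω, a⟩ := x
  simp only [Function.Involutive.coe_toPerm, f, Function.update_idem, Function.update_eq_self]
  congr 1
  rw [← Finset.mul_prod_erase _ _ (Finset.mem_univ k),
    ← Finset.mul_prod_erase _ (fun j => p (Function.update ω k a j)) (Finset.mem_univ k)]
  have : ∏ j ∈ Finset.univ.erase k, p (Function.update ω k a j) =
      ∏ j ∈ Finset.univ.erase k, p (ω j) := by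
    refine Finset.prod_congr rfl fun j hj => ?_
    rw [Function.update_of_ne (Finset.ne_of_mem_erase hj)]
  rw [this, Function.update_self]
  ring

lemma expec_apply (hs : ∑ a, p a = 1) (k : Fin K) (g : Fin (2 ^ M) → ℝ) :
    expec p (fun ω : Fin K → Fin (2 ^ M) => g (ω k)) = ∑ a, p a * g a := by
  rw [expec_resample hs k]
  simp only [Function.update_self]
  exact expec_const hs _

lemma expec_integral {a b : ℝ} {f : (Fin K → Fin (2 ^ M)) → ℝ → ℝ}
    (hf : ∀ ω, IntervalIntegrable (f ω) volume a b) :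
    expec p (fun ω => ∫ s in a..b, f ω s) = ∫ s in a..b, expec p (fun ω => f ω s) := by
  simp only [expec]
  rw [intervalIntegral.integral_finsetSum (fun ω _ => (hf ω).const_mul _)]
  simp

lemma expec_sq (hp : ∀ a, 0 ≤ p a) (hs : ∑ a, p a = 1) (X : (Fin K → Fin (2 ^ M)) → ℝ) :
    expec p X ≤ Real.sqrt (expec p (fun ω => X ω ^ 2)) := by
  apply Real.le_sqrt_of_sq_le
  set e := expec p X with he
  have h0 : 0 ≤ expec p (fun ω => X ω ^ 2 + (-2 * e * X ω + e ^ 2)) :=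
    expec_nonneg hp fun ω => by nlinarith [sq_nonneg (X ω - e)]
  rw [expec_add, expec_add, expec_const_mul, expec_const hs, ← he] at h0
  nlinarith

lemma batch_mean {As : Fin M → Matrix (Fin n) (Fin n) ℝ} {S : Fin (2 ^ M) → Finset (Fin M)}
    (hpi : ∀ i, 0 < piP S p i) : ∑ a, p a • batchM As S p a = ∑ j, As j := by
  have : ∀ a, p a • batchM As S p a =
      ∑ m, if m ∈ S a then (p a * (piP S p m)⁻¹) • As m else 0 := by
    intro a
    rw [batchM, Finset.smul_sum, ← Finset.sum_filter]
    simp [smul_smul]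
  simp only [this]
  rw [Finset.sum_comm]
  refine Finset.sum_congr rfl fun m _ => ?_
  rw [← Finset.sum_filter, ← Finset.sum_smul, ← Finset.sum_mul]
  have h := hpi m
  have h2 : ∑ i with m ∈ S i, p i = piP S p m := rfl
  rw [h2, mul_inv_cancel₀ h.ne', one_smul]

end expectation

lemma frob_sq (X : Matrix (Fin n) (Fin n) ℝ) : ‖X‖ ^ 2 = ∑ i, ∑ j, X i j ^ 2 := by
  rw [← ip_self, ip_eq_sum]; simp [sq]

lemma clm_apply_sq (X : Matrix (Fin n) (Fin n) ℝ) (v : EuclideanSpace ℝ (Fin n)) :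
    ‖clm X v‖ ^ 2 = ∑ i, (∑ j, X i j * v j) ^ 2 := by
  rw [EuclideanSpace.norm_sq_eq]
  refine Finset.sum_congr rfl fun i _ => ?_
  simp [clm, Matrix.mulVec, dotProduct]

lemma opN_le_frob (X : Matrix (Fin n) (Fin n) ℝ) : opN X ≤ ‖X‖ := by
  refine ContinuousLinearMap.opNorm_le_bound _ (norm_nonneg _) fun v => ?_
  refine le_of_sq_le_sq ?_ (by positivity)
  rw [clm_apply_sq, mul_pow, frob_sq, EuclideanSpace.norm_sq_eq, Finset.sum_mul]
  refine Finset.sum_le_sum fun i _ => ?_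
  simpa using Finset.sum_mul_sq_le_sq_mul_sq Finset.univ (fun j => X i j) (fun j => v j)

lemma frob_le_opN (X : Matrix (Fin n) (Fin n) ℝ) : ‖X‖ ^ 2 ≤ n * opN X ^ 2 := by
  rw [frob_sq, Finset.sum_comm]
  have : ∀ j, ∑ i, X i j ^ 2 ≤ opN X ^ 2 := by
    intro j
    have h := (clm X).le_opNorm (EuclideanSpace.single j (1 : ℝ))
    have h2 := pow_le_pow_left₀ (norm_nonneg _) h 2
    rw [clm_apply_sq] at h2
    simpa [opN] using h2
  calc _ ≤ ∑ _j : Fin n, opN X ^ 2 := Finset.sum_le_sum fun j _ => this j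
    _ = _ := by simp


lemma down_ind {K : ℕ} {Pr : ℕ → Prop} (hK : Pr K) (h : ∀ i < K, Pr (i + 1) → Pr i) :
    ∀ i ≤ K, Pr i := by
  intro i hi
  obtain ⟨d, rfl⟩ := Nat.exists_eq_add_of_le hi
  clear hi
  induction d generalizing i with
  | zero => exact hK
  | succ d ih =>
    apply h i (by omega)
    apply ih
    · rwa [show i + 1 + d = i + (d + 1) by omega]
    · rwa [show i + 1 + d = i + (d + 1) by omega]

lemma piece_cover {K : ℕ} {T h : ℝ} (hh : 0 < h) (hT : 0 < T) (hTK : T = K * h) {t : ℝ}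
    (ht : t ∈ Icc 0 T) : ∃ i < K, t ∈ Icc ((i : ℝ) * h) (((i + 1 : ℕ) : ℝ) * h) := by
  have hK : 0 < K := by
    rcases Nat.eq_zero_or_pos K with h0 | h0
    · subst h0; simp at hTK; linarith
    · exact h0
  rcases eq_or_lt_of_le ht.2 with h1 | h1
  · refine ⟨K - 1, by omega, ?_⟩
    have : K - 1 + 1 = K := by omega
    rw [this, ← hTK, h1]
    refine ⟨?_, le_refl _⟩
    rw [hTK]
    apply mul_le_mul_of_nonneg_right _ hh.le
    exact_mod_cast Nat.sub_le _ _
  · refine ⟨⌊t / h⌋₊, ?_, ?_, ?_⟩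
    · rw [Nat.floor_lt (div_nonneg ht.1 hh.le), div_lt_iff₀ hh]; linarith
    · rw [← le_div_iff₀ hh]; exact Nat.floor_le (div_nonneg ht.1 hh.le)
    · rw [← div_le_iff₀ hh]; push_cast; exact (Nat.lt_floor_add_one _).le

lemma piece_sub {K : ℕ} {T h : ℝ} (hh : 0 < h) (hTK : T = K * h) {i : ℕ} (hi : i < K) :
    0 ≤ (i : ℝ) * h ∧ (i : ℝ) * h < ((i + 1 : ℕ) : ℝ) * h ∧ ((i + 1 : ℕ) : ℝ) * h ≤ T := by
  refine ⟨by positivity, ?_, ?_⟩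
  · apply mul_lt_mul_of_pos_right _ hh; push_cast; linarith
  · rw [hTK]; apply mul_le_mul_of_nonneg_right _ hh.le
    exact_mod_cast hi

lemma AR_eq {M K : ℕ} {As : Fin M → Matrix (Fin n) (Fin n) ℝ}
    {S : Fin (2 ^ M) → Finset (Fin M)} {p : Fin (2 ^ M) → ℝ} {h : ℝ} (hh : 0 < h)
    (ω : Fin K → Fin (2 ^ M)) (i : Fin K) {s : ℝ}
    (hs : s ∈ Ico ((i : ℝ) * h) (((i + 1 : ℕ) : ℝ) * h)) :
    AR As S p h ω s = batchM As S p (ω i) := by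
  have hK : 0 < K := i.pos
  have hf : ⌊s / h⌋₊ = (i : ℕ) := by
    rw [Nat.floor_eq_iff]
    · refine ⟨(le_div_iff₀ hh).mpr hs.1, (div_lt_iff₀ hh).mpr ?_⟩
      have := hs.2
      push_cast at this
      exact this
    · exact div_nonneg (le_trans (by positivity) hs.1) hh.le
  rw [AR, dif_pos hK]
  congr 2
  apply Fin.ext
  simp only [hf]
  have := i.isLt
  omega

lemma pieces_integral {E : Type*} [NormedAddCommGroup E] [NormedSpace ℝ E] [CompleteSpace E]
    {K : ℕ} {T h : ℝ} (hh : 0 < h) (hTK : T = K * h)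
    {f g : ℝ → E} {F : E} {gc : Fin K → ℝ → E}
    (hc : ∀ i : Fin K, ∀ s ∈ Ico ((i : ℝ) * h) (((i + 1 : ℕ) : ℝ) * h), g s = gc i s)
    (hcR : ∀ i : Fin K, ContinuousOn (gc i) (Icc ((i : ℝ) * h) (((i + 1 : ℕ) : ℝ) * h)))
    (hP : ∀ t ∈ Icc (0 : ℝ) T, f t = F + ∫ s in t..T, g s) :
    ∀ i : Fin K, ∀ t ∈ Icc ((i : ℝ) * h) (((i + 1 : ℕ) : ℝ) * h),
      f t = f (((i + 1 : ℕ) : ℝ) * h) + ∫ s in t..(((i + 1 : ℕ) : ℝ) * h), gc i s := by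
  have hsubI : ∀ i : Fin K, Icc ((i : ℝ) * h) (((i + 1 : ℕ) : ℝ) * h) ⊆ Icc 0 T := fun i =>
    Icc_subset_Icc (piece_sub hh hTK i.isLt).1 (piece_sub hh hTK i.isLt).2.2
  have hpi : ∀ i < K, IntervalIntegrable g volume
      ((i : ℝ) * h) (((i + 1 : ℕ) : ℝ) * h) := by
    intro i hi
    have hle := (piece_sub hh hTK hi).2.1.le
    have h1 : IntervalIntegrable (gc ⟨i, hi⟩) volume
        ((i : ℝ) * h) (((i + 1 : ℕ) : ℝ) * h) :=
      ContinuousOn.intervalIntegrable_of_Icc hle (hcR ⟨i, hi⟩)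
    refine h1.congr_uIoo ?_
    intro s hs
    rw [uIoo_of_le hle] at hs
    exact (hc ⟨i, hi⟩ s ⟨hs.1.le, hs.2⟩).symm
  have hall : IntervalIntegrable g volume 0 T := by
    have := IntervalIntegrable.trans_iterate (a := fun i : ℕ => (i : ℝ) * h) (n := K) hpi
    simpa [hTK] using this
  have hT0 : 0 ≤ T := by rw [hTK]; positivity
  have hmono : ∀ t ∈ Icc 0 T, IntervalIntegrable g volume t T := by
    intro t ht
    apply hall.mono_set
    rw [uIcc_of_le ht.2, uIcc_of_le hT0]
    exact Icc_subset_Icc_left ht.1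
  intro i t ht
  obtain ⟨h0, h1, h2⟩ := piece_sub hh hTK i.isLt
  have ht' := hsubI i ht
  have hb' := hsubI i (right_mem_Icc.mpr h1.le)
  have h3 : ∫ s in t..((i + 1 : ℕ) : ℝ) * h, gc i s = ∫ s in t..((i + 1 : ℕ) : ℝ) * h, g s := by
    apply intervalIntegral.integral_congr_Ioo_of_le ht.2
    intro s hs
    exact (hc i s ⟨ht.1.trans hs.1.le, hs.2⟩).symm
  rw [h3, hP t ht', hP _ hb', add_assoc, add_right_inj,
    ← intervalIntegral.integral_add_adjacent_intervals (b := ((i + 1 : ℕ) : ℝ) * h) _ (hmono _ hb'),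
    add_comm]
  exact (hmono t ht').mono_set (by
    rw [uIcc_of_le ht.2, uIcc_of_le ht'.2]; exact Icc_subset_Icc_right h2)

lemma PR_intSol {K : ℕ} {T h : ℝ} (hh : 0 < h) (hTK : T = K * h)
    {P : ℝ → Matrix (Fin n) (Fin n) ℝ} {F G Q : Matrix (Fin n) (Fin n) ℝ}
    {Af : ℝ → Matrix (Fin n) (Fin n) ℝ} {c : Fin K → Matrix (Fin n) (Fin n) ℝ}
    (hc : ∀ i : Fin K, ∀ s ∈ Ico ((i : ℝ) * h) (((i + 1 : ℕ) : ℝ) * h), Af s = c i)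
    (hcont : ContinuousOn P (Icc 0 T))
    (hP : ∀ t ∈ Icc (0 : ℝ) T, P t = F + ∫ s in t..T, Ric (Af s) G Q (P s)) :
    ∀ i : Fin K, IntSol (c i) G Q P ((i : ℝ) * h) (((i + 1 : ℕ) : ℝ) * h) := by
  have hsubI : ∀ i : Fin K, Icc ((i : ℝ) * h) (((i + 1 : ℕ) : ℝ) * h) ⊆ Icc 0 T := fun i =>
    Icc_subset_Icc (piece_sub hh hTK i.isLt).1 (piece_sub hh hTK i.isLt).2.2
  have hcR : ∀ i : Fin K, ContinuousOn (fun s => Ric (c i) G Q (P s))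
      (Icc ((i : ℝ) * h) (((i + 1 : ℕ) : ℝ) * h)) := fun i =>
    (continuous_Ric _ _ _).comp_continuousOn (hcont.mono (hsubI i))
  intro i
  refine intSol_of_integral (piece_sub hh hTK i.isLt).2.1.le (hcont.mono (hsubI i)) ?_
  exact pieces_integral hh hTK (gc := fun i s => Ric (c i) G Q (P s))
    (g := fun s => Ric (Af s) G Q (P s)) (f := P) (F := F)
    (fun i s hs => by rw [hc i s hs]) hcR hP i

lemma pieces_psd {K : ℕ} {T h : ℝ} (hh : 0 < h) (hT : 0 < T) (hTK : T = K * h)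
    {P : ℝ → Matrix (Fin n) (Fin n) ℝ} {G Q : Matrix (Fin n) (Fin n) ℝ}
    {c : Fin K → Matrix (Fin n) (Fin n) ℝ} (hG : G.PosSemidef) (hQ : Q.PosSemidef)
    (hF : (P T).PosSemidef)
    (hS : ∀ i : Fin K, IntSol (c i) G Q P ((i : ℝ) * h) (((i + 1 : ℕ) : ℝ) * h)) :
    ∀ t ∈ Icc 0 T, (P t).PosSemidef := by
  have key : ∀ i ≤ K, (P ((i : ℝ) * h)).PosSemidef := by
    apply down_ind
    · rwa [← hTK]
    · intro i hi h1
      exact intSol_psd (psd_symm hG) hQ (hS ⟨i, hi⟩) h1 _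
        (left_mem_Icc.mpr (piece_sub hh hTK hi).2.1.le)
  intro t ht
  obtain ⟨i, hi, hti⟩ := piece_cover hh hT hTK ht
  exact intSol_psd (psd_symm hG) hQ (hS ⟨i, hi⟩) (key (i + 1) hi) t hti

lemma pieces_norm {K : ℕ} {T h μ : ℝ} (hh : 0 < h) (hT : 0 < T) (hTK : T = K * h)
    {P : ℝ → Matrix (Fin n) (Fin n) ℝ} {G Q : Matrix (Fin n) (Fin n) ℝ}
    {c : Fin K → Matrix (Fin n) (Fin n) ℝ} (hG : G.PosSemidef) (hμ : 0 ≤ μ)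
    (hS : ∀ i : Fin K, IntSol (c i) G Q P ((i : ℝ) * h) (((i + 1 : ℕ) : ℝ) * h))
    (hpsd : ∀ t ∈ Icc 0 T, (P t).PosSemidef)
    (hA : ∀ i, ∀ x : Fin n → ℝ, x ⬝ᵥ (c i *ᵥ x) ≤ μ * (eN x) ^ 2) :
    ∀ t ∈ Icc 0 T, ‖P t‖ ^ 2 ≤
      (1 + Real.exp T * (‖P T‖ ^ 2 + ‖Q‖ ^ 2 * T)) * Real.exp (4 * μ * (T - t)) := by
  have hb : ∀ i (hi : i < K), ∀ t ∈ Icc ((i : ℝ) * h) (((i + 1 : ℕ) : ℝ) * h), _ := fun i hi =>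
    norm_bound (T := T) hG (hS ⟨i, hi⟩) (fun t ht => hpsd t
      ⟨(piece_sub hh hTK hi).1.trans ht.1, ht.2.trans (piece_sub hh hTK hi).2.2⟩) hμ
      (piece_sub hh hTK hi).2.2 (hA ⟨i, hi⟩)
  have key : ∀ i ≤ K, Real.exp (-((4 * μ + 1) * (T - i * h))) * ‖P (i * h)‖ ^ 2 ≤
      ‖P T‖ ^ 2 + ‖Q‖ ^ 2 * (T - i * h) := by
    apply down_ind
    · rw [← hTK]; simp
    · intro i hi h1
      have h2 := hb i hi _ (left_mem_Icc.mpr (piece_sub hh hTK hi).2.1.le)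
      linarith
  intro t ht
  obtain ⟨i, hi, hti⟩ := piece_cover hh hT hTK ht
  have h1 := hb i hi t hti
  have h2 := key (i + 1) hi
  have h3 : Real.exp (-((4 * μ + 1) * (T - t))) * ‖P t‖ ^ 2 ≤ ‖P T‖ ^ 2 + ‖Q‖ ^ 2 * T := by
    have : 0 ≤ ‖Q‖ ^ 2 * t := mul_nonneg (by positivity) ht.1
    linarith
  rw [Real.exp_neg, inv_mul_le_iff₀ (Real.exp_pos _)] at h3
  have h4 : Real.exp ((4 * μ + 1) * (T - t)) ≤ Real.exp (4 * μ * (T - t)) * Real.exp T := by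
    rw [← Real.exp_add]; apply Real.exp_le_exp.mpr; linarith [ht.1]
  have h5 : 0 ≤ ‖P T‖ ^ 2 + ‖Q‖ ^ 2 * T := by positivity
  have h6 := Real.exp_pos (4 * μ * (T - t))
  calc _ ≤ _ := h3
    _ ≤ Real.exp (4 * μ * (T - t)) * Real.exp T * (‖P T‖ ^ 2 + ‖Q‖ ^ 2 * T) :=
        mul_le_mul_of_nonneg_right h4 h5
    _ ≤ _ := by linarith

lemma pieces_unique {K : ℕ} {T h : ℝ} (hh : 0 < h) (hTK : T = K * h)
    {P P' : ℝ → Matrix (Fin n) (Fin n) ℝ} {G Q : Matrix (Fin n) (Fin n) ℝ}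
    {c c' : Fin K → Matrix (Fin n) (Fin n) ℝ}
    (hS : ∀ i : Fin K, IntSol (c i) G Q P ((i : ℝ) * h) (((i + 1 : ℕ) : ℝ) * h))
    (hS' : ∀ i : Fin K, IntSol (c' i) G Q P' ((i : ℝ) * h) (((i + 1 : ℕ) : ℝ) * h))
    (hF : P T = P' T) :
    ∀ i ≤ K, (∀ j : Fin K, i ≤ j → c j = c' j) → P ((i : ℝ) * h) = P' ((i : ℝ) * h) := by
  apply down_ind
  · intro _; rwa [← hTK]
  · intro i hi h1 hc
    have h2 := h1 fun j hj => hc j (by omega)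
    have h3 := hS' ⟨i, hi⟩
    rw [← hc ⟨i, hi⟩ le_rfl] at h3
    exact intSol_unique (hS ⟨i, hi⟩) h3 h2 (left_mem_Icc.mpr (piece_sub hh hTK hi).2.1.le)

/-- The linear map `D ↦ ⟨E, Dᵀ R + R D⟩`. -/
noncomputable def ipLin (E R : Matrix (Fin n) (Fin n) ℝ) : Matrix (Fin n) (Fin n) ℝ →ₗ[ℝ] ℝ where
  toFun D := ip E (Dᵀ * R + R * D)
  map_add' X Y := by
    rw [← ip_add_right]; congr 1
    rw [Matrix.transpose_add, add_mul, mul_add]; abel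
  map_smul' c X := by
    simp [ip, Matrix.mul_add]
    ring

lemma expec_mid {M K : ℕ} {p : Fin (2 ^ M) → ℝ} (hs : ∑ a, p a = 1) (k : Fin K)
    {Eb : (Fin K → Fin (2 ^ M)) → Matrix (Fin n) (Fin n) ℝ}
    (hEb : ∀ ω a, Eb (Function.update ω k a) = Eb ω)
    {D : Fin (2 ^ M) → Matrix (Fin n) (Fin n) ℝ} (hD : ∑ a, p a • D a = 0)
    {θ : ℝ → ℝ} {R : ℝ → Matrix (Fin n) (Fin n) ℝ} {t b : ℝ} (htb : t ≤ b)
    (hθ : ContinuousOn θ (Icc t b)) (hR : ContinuousOn R (Icc t b)) :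
    expec p (fun ω : Fin K → Fin (2 ^ M) => ∫ s in t..b,
      θ s * ip (Eb ω) ((D (ω k))ᵀ * R s + R s * D (ω k))) = 0 := by
  rw [expec_integral]
  · have : ∀ s, expec p (fun ω : Fin K → Fin (2 ^ M) =>
        θ s * ip (Eb ω) ((D (ω k))ᵀ * R s + R s * D (ω k))) = 0 := by
      intro s
      rw [expec_resample hs k]
      have h0 : ∀ ω : Fin K → Fin (2 ^ M), ∑ a, p a * (θ s * ip (Eb (Function.update ω k a))
          ((D (Function.update ω k a k))ᵀ * R s + R s * D (Function.update ω k a k))) = 0 := by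
        intro ω
        simp only [hEb, Function.update_self]
        have h1 := congrArg (ipLin (Eb ω) (R s)) hD
        rw [map_sum, map_zero] at h1
        simp only [map_smul, smul_eq_mul] at h1
        have h2 : ∀ a, p a * (θ s * ip (Eb ω) ((D a)ᵀ * R s + R s * D a)) =
            θ s * (p a * ipLin (Eb ω) (R s) (D a)) := fun a => by
          simp only [ipLin, LinearMap.coe_mk, AddHom.coe_mk]; ring
        simp only [h2]
        rw [← Finset.mul_sum, h1, mul_zero]
      simp only [h0]
      exact expec_const hs 0
    simp [this]
  · intro ω
    apply ContinuousOn.intervalIntegrable_of_Icc htb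
    refine hθ.mul ?_
    have hcc : Continuous (fun Y : Matrix (Fin n) (Fin n) ℝ =>
        ip (Eb ω) ((D (ω k))ᵀ * Y + Y * D (ω k))) :=
      continuous_ip.comp (continuous_const.prodMk
        ((continuous_const.mul continuous_id).add (continuous_id.mul continuous_const)))
    exact hcc.comp_continuousOn hR

set_option maxHeartbeats 2000000 in
lemma core_bound {A G Q F : Matrix (Fin n) (Fin n) ℝ} (hG : G.PosSemidef) (hQ : Q.PosSemidef)
    (hF : F.PosSemidef) {T k : ℝ} (hT : 0 < T) (hk0 : 0 ≤ k)
    {PT : ℝ → Matrix (Fin n) (Fin n) ℝ} (hPT : IntSol A G Q PT 0 T) (hPTF : PT T = F)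
    (hPTk : ∀ t ∈ Icc 0 T, ‖PT t‖ ≤ k)
    {M K : ℕ} {As : Fin M → Matrix (Fin n) (Fin n) ℝ}
    {S : Fin (2 ^ M) → Finset (Fin M)} {p : Fin (2 ^ M) → ℝ} {h μ : ℝ}
    (hAs : A = ∑ j, As j) (hp : ∀ a, 0 ≤ p a) (hs : ∑ a, p a = 1) (hpi : ∀ i, 0 < piP S p i)
    (hh : 0 < h) (hTK : T = K * h) (hμ : 0 ≤ μ)
    (hA : ∀ (ω : Fin K → Fin (2 ^ M)) (t : ℝ), t ∈ Icc (0 : ℝ) T →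
          ∀ x : Fin n → ℝ, x ⬝ᵥ (AR As S p h ω t *ᵥ x) ≤ μ * (eN x) ^ 2)
    {PR : (Fin K → Fin (2 ^ M)) → ℝ → Matrix (Fin n) (Fin n) ℝ}
    (hcont : ∀ ω, ContinuousOn (PR ω) (Icc 0 T))
    (hPR : ∀ ω, ∀ t ∈ Icc (0 : ℝ) T,
      PR ω t = F + ∫ s in t..T, Ric (AR As S p h ω s) G Q (PR ω s)) :
    ∀ t ∈ Icc 0 T, expec p (fun ω => ‖PR ω t - PT t‖ ^ 2) ≤
      Real.exp ((4 * μ + 6 * ‖G‖ * k) * (T - t)) * (Real.exp (2 * T) * (T *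
        ((2 * (1 + Real.exp T * (‖F‖ ^ 2 + ‖Q‖ ^ 2 * T)) *
          (T * (k ^ 2 * (2 * ‖A‖ + k * ‖G‖ + ‖G‖) ^ 2) + 4 * k)) *
          (n * (h * varAR A As S p))))) := by
  have hFT : ∀ ω, PR ω T = F := fun ω => by
    have := hPR ω T (right_mem_Icc.mpr hT.le)
    rwa [intervalIntegral.integral_same, add_zero] at this
  have hS : ∀ ω, ∀ i : Fin K, IntSol (batchM As S p (ω i)) G Q (PR ω)
      ((i : ℝ) * h) (((i + 1 : ℕ) : ℝ) * h) := fun ω =>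
    PR_intSol hh hTK (c := fun i => batchM As S p (ω i)) (fun i s hs => AR_eq hh ω i hs)
      (hcont ω) (hPR ω)
  have hAk : ∀ ω : Fin K → Fin (2 ^ M), ∀ i : Fin K, ∀ x : Fin n → ℝ,
      x ⬝ᵥ (batchM As S p (ω i) *ᵥ x) ≤ μ * (eN x) ^ 2 := by
    intro ω i x
    obtain ⟨h0, h1, h2⟩ := piece_sub hh hTK i.isLt
    have := hA ω ((i : ℝ) * h) ⟨h0, h1.le.trans h2⟩ x
    rwa [AR_eq hh ω i ⟨le_rfl, h1⟩] at this
  have hpsd : ∀ ω, ∀ t ∈ Icc 0 T, (PR ω t).PosSemidef := fun ω =>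
    pieces_psd hh hT hTK (c := fun i => batchM As S p (ω i)) hG hQ (by rw [hFT]; exact hF) (hS ω)
  set Ck := 1 + Real.exp T * (‖F‖ ^ 2 + ‖Q‖ ^ 2 * T) with hCk
  have hCk1 : 1 ≤ Ck := by
    have : 0 ≤ Real.exp T * (‖F‖ ^ 2 + ‖Q‖ ^ 2 * T) := by positivity
    linarith
  have hnorm : ∀ ω, ∀ t ∈ Icc 0 T, ‖PR ω t‖ ^ 2 ≤ Ck * Real.exp (4 * μ * (T - t)) := by
    intro ω t ht
    have := pieces_norm hh hT hTK (c := fun i => batchM As S p (ω i)) hG hμ (hS ω) (hpsd ω)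
      (hAk ω) t ht
    rwa [hFT] at this
  have hPTs : ∀ t ∈ Icc 0 T, (PT t)ᵀ = PT t :=
    intSol_symm (psd_symm hG) (psd_symm hQ) hPT (by rw [hPTF]; exact psd_symm hF)
  set l := 4 * μ + 6 * ‖G‖ * k with hl
  set c6 := 2 * Ck * (T * (k ^ 2 * (2 * ‖A‖ + k * ‖G‖ + ‖G‖) ^ 2) + 4 * k) with hc6
  have hc60 : 0 ≤ c6 := by
    have : 0 ≤ Ck := by linarith
    positivity
  set V := varAR A As S p with hV
  have hV0 : 0 ≤ V := Finset.sum_nonneg fun a _ => mul_nonneg (hp a) (sq_nonneg _)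
  set β := h ^ 2 * c6 * (n * V) with hβ
  have hβ0 : 0 ≤ β := by positivity
  let y : ℝ → ℝ := fun t => expec p (fun ω => Real.exp (-(l * (T - t))) * ‖PR ω t - PT t‖ ^ 2)
  have hφc : ∀ ω, ContinuousOn (fun t => Real.exp (-(l * (T - t))) * ‖PR ω t - PT t‖ ^ 2)
      (Icc 0 T) := fun ω => by
    have h1 : Continuous (fun s => Real.exp (-(l * (T - s)))) := by fun_prop
    exact h1.continuousOn.mul (((hcont ω).sub hPT.continuousOn).norm.pow 2)
  have hyc : ContinuousOn y (Icc 0 T) := by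
    simp only [y, expec]
    exact continuousOn_finsetSum _ fun ω _ => continuousOn_const.mul (hφc ω)
  have hy0 : ∀ t, 0 ≤ y t := fun t => expec_nonneg hp fun ω => by positivity
  have hmean : ∑ a, p a • (batchM As S p a - A) = 0 := by
    simp only [smul_sub]
    rw [Finset.sum_sub_distrib, batch_mean hpi, ← Finset.sum_smul, hs, one_smul, hAs, sub_self]
  have hvar : ∀ i : Fin K, expec p (fun ω : Fin K → Fin (2 ^ M) =>
      ‖batchM As S p (ω i) - A‖ ^ 2) ≤ n * V := by
    intro i
    rw [expec_apply hs i (fun a => ‖batchM As S p a - A‖ ^ 2), hV, varAR, Finset.mul_sum]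
    refine Finset.sum_le_sum fun a _ => ?_
    rw [norm_sub_rev]
    have := mul_le_mul_of_nonneg_left (frob_le_opN (A - batchM As S p a)) (hp a)
    linarith
  have hstep : ∀ i < K, ∀ t ∈ Icc ((i : ℝ) * h) (((i + 1 : ℕ) : ℝ) * h),
      y t ≤ Real.exp (2 * (((i + 1 : ℕ) : ℝ) * h - t)) * (y (((i + 1 : ℕ) : ℝ) * h) + β) := by
    intro i hi
    obtain ⟨h0, h1, h2⟩ := piece_sub hh hTK hi
    have hsub : Icc ((i : ℝ) * h) (((i + 1 : ℕ) : ℝ) * h) ⊆ Icc 0 T := Icc_subset_Icc h0 h2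
    have hlen : ((i + 1 : ℕ) : ℝ) * h - (i : ℝ) * h = h := by push_cast; ring
    have huni : ∀ ω a, PR (Function.update ω ⟨i, hi⟩ a) (((i + 1 : ℕ) : ℝ) * h) =
        PR ω (((i + 1 : ℕ) : ℝ) * h) := by
      intro ω a
      refine pieces_unique hh hTK (hS (Function.update ω ⟨i, hi⟩ a)) (hS ω) (by rw [hFT, hFT])
        (i + 1) hi ?_
      intro j hj
      have hne : j ≠ ⟨i, hi⟩ := by
        intro hEq
        rw [hEq] at hj
        simp at hj
      simp only [Function.update_of_ne hne]
    generalize hbdef : ((i + 1 : ℕ) : ℝ) * h = b at *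
    generalize hadef : (i : ℝ) * h = a at *
    refine gronwall_int (hyc.mono hsub) h1.le fun t ht => ?_
    have hsubt : Icc t b ⊆ Icc 0 T := Icc_subset_Icc (h0.trans ht.1) h2
    have hST : ∀ ω, IntSol (batchM As S p (ω ⟨i, hi⟩)) G Q (PR ω) a b := fun ω => by
      have := hS ω ⟨i, hi⟩
      simp only [hbdef, hadef] at this
      exact this
    have hsb : ∀ ω, _ := fun ω => step_bound (Ck := Ck) hG hμ hCk1 hk0 h1 h2
      (by linarith) (hST ω) (hPT.mono h0 h2) (fun s hs => hpsd ω s (hsub hs))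
      (fun s hs => hPTs s (hsub hs)) (fun s hs => hPTk s (hsub hs))
      (fun s hs => hnorm ω s (hsub hs)) (hAk ω ⟨i, hi⟩) t ht
    simp only [← hl, ← hc6, hlen] at hsb
    have hE := expec_mono hp hsb
    have hIntg : expec p (fun ω => 2 * ∫ s in t..b, Real.exp (-(l * (T - s))) *
        ‖PR ω s - PT s‖ ^ 2) = 2 * ∫ s in t..b, y s := by
      rw [expec_const_mul, expec_integral]
      intro ω
      exact ContinuousOn.intervalIntegrable_of_Icc ht.2 ((hφc ω).mono hsubt)
    have hmid := expec_mid hs (⟨i, hi⟩ : Fin K) (Eb := fun ω => PR ω b - PT b)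
      (fun ω a => by rw [huni]) hmean (θ := fun s => 2 * Real.exp (-(l * (T - s)))) ht.2
      (by fun_prop) (hPT.continuousOn.mono hsubt)
    have hDD := expec_const_mul (p := p) (h ^ 2 * c6) (fun ω : Fin K → Fin (2 ^ M) =>
      ‖batchM As S p (ω ⟨i, hi⟩) - A‖ ^ 2)
    rw [expec_add, expec_add, expec_add, hmid, hIntg, hDD] at hE
    have hv := mul_le_mul_of_nonneg_left (hvar ⟨i, hi⟩) (show 0 ≤ h ^ 2 * c6 by positivity)
    have hyt : y t = expec p (fun ω => Real.exp (-(l * (T - t))) * ‖PR ω t - PT t‖ ^ 2) := rfl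
    have hyb : y b = expec p (fun ω => Real.exp (-(l * (T - b))) * ‖PR ω b - PT b‖ ^ 2) := rfl
    rw [hyt, hyb]
    linarith
  have hcomb : ∀ i < K, y (((i + 1 : ℕ) : ℝ) * h) ≤
        Real.exp (2 * (T - ((i + 1 : ℕ) : ℝ) * h)) * ((K - ((i + 1 : ℕ) : ℝ)) * β) →
      ∀ t ∈ Icc ((i : ℝ) * h) (((i + 1 : ℕ) : ℝ) * h),
        y t ≤ Real.exp (2 * (T - t)) * ((K - (i : ℝ)) * β) := by
    intro i hi hy t ht
    obtain ⟨h0, h1, h2⟩ := piece_sub hh hTK hi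
    have h3 : β ≤ Real.exp (2 * (T - ((i + 1 : ℕ) : ℝ) * h)) * β := by
      have : 1 ≤ Real.exp (2 * (T - ((i + 1 : ℕ) : ℝ) * h)) := Real.one_le_exp (by linarith)
      nlinarith
    calc y t ≤ _ := hstep i hi t ht
      _ ≤ Real.exp (2 * (((i + 1 : ℕ) : ℝ) * h - t)) *
          (Real.exp (2 * (T - ((i + 1 : ℕ) : ℝ) * h)) * ((K - (i : ℝ)) * β)) := by
        apply mul_le_mul_of_nonneg_left _ (Real.exp_pos _).le
        push_cast at hy h3 ⊢
        linarith
      _ = _ := by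
        rw [← mul_assoc, ← Real.exp_add]
        congr 2
        ring
  have hind : ∀ i ≤ K, y ((i : ℝ) * h) ≤ Real.exp (2 * (T - (i : ℝ) * h)) * ((K - (i : ℝ)) * β) := by
    apply down_ind
    · rw [← hTK]
      simp [y, hFT, hPTF, expec]
    · intro i hi hy
      exact hcomb i hi hy _ (left_mem_Icc.mpr (piece_sub hh hTK hi).2.1.le)
  intro t ht
  obtain ⟨i, hi, hti⟩ := piece_cover hh hT hTK ht
  have hyt := hcomb i hi (hind (i + 1) hi) t hti
  have hyt2 : y t ≤ Real.exp (2 * T) * (T * (c6 * (n * (h * V)))) := by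
    refine hyt.trans ?_
    have e1 : Real.exp (2 * (T - t)) ≤ Real.exp (2 * T) :=
      Real.exp_le_exp.mpr (by linarith [ht.1])
    have e2 : (K - (i : ℝ)) * β ≤ T * (c6 * (n * (h * V))) := by
      have : (K - (i : ℝ)) * β ≤ K * β :=
        mul_le_mul_of_nonneg_right (by linarith [Nat.cast_nonneg (α := ℝ) i]) hβ0
      refine this.trans (le_of_eq ?_)
      rw [hβ, hTK]; ring
    have e3 : 0 ≤ (K - (i : ℝ)) * β := by
      apply mul_nonneg _ hβ0
      have : (i : ℝ) ≤ K := by exact_mod_cast hi.le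
      linarith
    exact mul_le_mul e1 e2 e3 (Real.exp_pos _).le
  have hyeq : expec p (fun ω => ‖PR ω t - PT t‖ ^ 2) = Real.exp (l * (T - t)) * y t := by
    simp only [y]
    rw [expec_const_mul, ← mul_assoc, ← Real.exp_add, add_neg_cancel, Real.exp_zero, one_mul]
  rw [hyeq]
  exact mul_le_mul_of_nonneg_left hyt2 (Real.exp_pos _).le

end helpers

/-- Expected distance between the randomized Riccati solution and the
deterministic Riccati solution: `E[‖P_R(·,t) − P_T(t)‖] ≤ C_T e^{2μ_R T} √(h Var[A_R])`. -/
theorem randomized_riccati_estimate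
    (n m : ℕ) (A : Matrix (Fin n) (Fin n) ℝ) (B : Matrix (Fin n) (Fin m) ℝ)
    (Q : Matrix (Fin n) (Fin n) ℝ) (W : Matrix (Fin m) (Fin m) ℝ)
    (F : Matrix (Fin n) (Fin n) ℝ)
    (hQ : Q.PosSemidef) (hW : W.PosDef) (hF : F.PosSemidef)
    (T : ℝ) (hT : 0 < T) (κ : ℝ) (hκ : 0 < κ)
    (PT : ℝ → Matrix (Fin n) (Fin n) ℝ)
    (hPT : ∀ t ∈ Icc (0 : ℝ) T,
      HasDerivAt PT (-(Aᵀ * PT t + PT t * A - PT t * B * W⁻¹ * Bᵀ * PT t + Q)) t)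
    (hPTF : PT T = F)
    (hPTκ : ∀ t ∈ Icc (0 : ℝ) T, opN (PT t) ≤ κ) :
    ∃ C : ℝ, 0 < C ∧
      ∀ (M K : ℕ) (As : Fin M → Matrix (Fin n) (Fin n) ℝ)
        (S : Fin (2 ^ M) → Finset (Fin M)) (p : Fin (2 ^ M) → ℝ) (h : ℝ) (μR : ℝ),
        A = ∑ j, As j →
        Function.Bijective S →
        (∀ ω, 0 ≤ p ω ∧ p ω ≤ 1) → (∑ ω, p ω) = 1 →
        (∀ i, 0 < piP S p i) →
        0 < h → T = K * h →
        0 ≤ μR →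
        (∀ (ω : Fin K → Fin (2 ^ M)) (t : ℝ), t ∈ Icc (0 : ℝ) T →
          ∀ x : Fin n → ℝ, x ⬝ᵥ (AR As S p h ω t *ᵥ x) ≤ μR * (eN x) ^ 2) →
        h * varAR A As S p ≤ 1 →
        ∀ PR : (Fin K → Fin (2 ^ M)) → ℝ → Matrix (Fin n) (Fin n) ℝ,
          (∀ ω, ContinuousOn (PR ω) (Icc 0 T)) →
          (∀ ω, ∀ t ∈ Icc (0 : ℝ) T,
            PR ω t = F + ∫ s in t..T, ((AR As S p h ω s)ᵀ * PR ω s + PR ω s * AR As S p h ω s -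
              PR ω s * B * W⁻¹ * Bᵀ * PR ω s + Q)) →
          ∀ t ∈ Icc (0 : ℝ) T,
            expec p (fun ω => opN (PR ω t - PT t)) ≤
              C * Real.exp (2 * μR * T) * Real.sqrt (h * varAR A As S p) := by
  obtain ⟨k₀, hk₀⟩ := (isCompact_Icc (a := (0 : ℝ)) (b := T)).exists_bound_of_continuousOn
    (f := PT) (fun t ht => (hPT t ht).continuousAt.continuousWithinAt)
  set k := max k₀ 0 with hk
  have hk0 : 0 ≤ k := le_max_right _ _
  have hPTk : ∀ t ∈ Icc 0 T, ‖PT t‖ ≤ k := fun t ht => (hk₀ t ht).trans (le_max_left _ _)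
  set G := B * W⁻¹ * Bᵀ with hGdef
  have hG : G.PosSemidef := by
    have := hW.inv.posSemidef.mul_mul_conjTranspose_same B
    rwa [Matrix.conjTranspose_eq_transpose_of_trivial] at this
  have hRic : ∀ X P : Matrix (Fin n) (Fin n) ℝ,
      Xᵀ * P + P * X - P * B * W⁻¹ * Bᵀ * P + Q = Ric X G Q P := by
    intro X P
    simp only [Ric, hGdef, Matrix.mul_assoc]
  have hPT' : IntSol A G Q PT 0 T := by
    intro t ht
    have := (hPT t ht).hasDerivWithinAt (s := Icc 0 T)
    rwa [hRic] at this
  set c6 := 2 * (1 + Real.exp T * (‖F‖ ^ 2 + ‖Q‖ ^ 2 * T)) *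
          (T * (k ^ 2 * (2 * ‖A‖ + k * ‖G‖ + ‖G‖) ^ 2) + 4 * k) with hc6
  have hc60 : 0 ≤ c6 := by positivity
  set c7 := Real.exp (6 * ‖G‖ * k * T) * (Real.exp (2 * T) * (T * (c6 * n))) with hc7
  have hc70 : 0 ≤ c7 := by positivity
  refine ⟨Real.sqrt c7 + 1, by positivity, ?_⟩
  intro M K As S p h μ hAs _ hp hs hpi hh hTK hμ hA _ PR hcont hPR t ht
  simp only [hRic] at hPR
  have hp0 : ∀ a, 0 ≤ p a := fun a => (hp a).1
  have hcore := core_bound hG hQ hF hT hk0 hPT' hPTF hPTk hAs hp0 hs hpi hh hTK hμ hA hcont hPR t ht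
  rw [← hc6] at hcore
  set V := varAR A As S p with hV
  have hV0 : 0 ≤ V := Finset.sum_nonneg fun a _ => mul_nonneg (hp0 a) (sq_nonneg _)
  have hb : expec p (fun ω => ‖PR ω t - PT t‖ ^ 2) ≤
      c7 * Real.exp (2 * μ * T) ^ 2 * (h * V) := by
    refine hcore.trans ?_
    have e1 : Real.exp ((4 * μ + 6 * ‖G‖ * k) * (T - t)) ≤
        Real.exp (6 * ‖G‖ * k * T) * Real.exp (2 * μ * T) ^ 2 := by
      rw [sq, ← Real.exp_add, ← Real.exp_add]
      apply Real.exp_le_exp.mpr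
      have : 0 ≤ (4 * μ + 6 * ‖G‖ * k) * t := mul_nonneg (by positivity) ht.1
      linarith
    have e2 : 0 ≤ Real.exp (2 * T) * (T * (c6 * (n * (h * V)))) := by positivity
    refine (mul_le_mul_of_nonneg_right e1 e2).trans (le_of_eq ?_)
    rw [hc7]; ring
  calc expec p (fun ω => opN (PR ω t - PT t)) ≤ expec p (fun ω => ‖PR ω t - PT t‖) :=
        expec_mono hp0 fun ω => opN_le_frob _
    _ ≤ Real.sqrt (expec p (fun ω => ‖PR ω t - PT t‖ ^ 2)) := expec_sq hp0 hs _
    _ ≤ Real.sqrt (c7 * Real.exp (2 * μ * T) ^ 2 * (h * V)) := Real.sqrt_le_sqrt hb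
    _ = Real.sqrt c7 * Real.exp (2 * μ * T) * Real.sqrt (h * V) := by
        rw [Real.sqrt_mul (by positivity), Real.sqrt_mul hc70, Real.sqrt_sq (Real.exp_pos _).le]
    _ ≤ _ := by
        have : 0 ≤ Real.exp (2 * μ * T) * Real.sqrt (h * V) := by positivity
        linarith
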